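/- arXiv:1202.2550 — 3 statements merged into one kernel-verified Lean document; each statement's English description precedes it below -/
import Mathlib

section
/- Lemma 3.4: let F be a distribution function with F(1) = 0, G(x) = F(e^x), y₀ = sup{x : G(x) < 1}, and r(u) = R_1(G⁻¹(1 − u), y₀, G). (i) If F ∈ D(φ) ∪ D(Λ), then r is slowly varying at zero. (ii) If F ∈ D(ψ_γ) for some γ > 0, then r is regularly varying at zero with exponent 1/γ. -/
open MeasureTheory Filter Topology Set

noncomputable section

/-- A distribution function: nondecreasing, right-continuous, with limits 0 at -∞ and 1 at +∞. -/
def IsDF (F : ℝ → ℝ) : Prop :=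
  Monotone F ∧ (∀ x, ContinuousWithinAt F (Set.Ici x) x) ∧
    Tendsto F atBot (𝓝 0) ∧ Tendsto F atTop (𝓝 1)

/-- `F` lies in the domain of attraction of `M`. -/
def MemDomAttr (F M : ℝ → ℝ) : Prop :=
  ∃ a b : ℕ → ℝ, (∀ n, 0 < a n) ∧
    ∀ x, ContinuousAt M x →
      Tendsto (fun n => F (a n * x + b n) ^ n) atTop (𝓝 (M x))

/-- The Gumbel distribution function Λ. -/
def gumbelDF (x : ℝ) : ℝ := Real.exp (-Real.exp (-x))

/-- The Fréchet distribution function φ_γ. -/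
def frechetDF (γ : ℝ) (x : ℝ) : ℝ := if 0 < x then Real.exp (-(x ^ (-γ))) else 0

/-- The Weibull distribution function ψ_γ. -/
def weibullDF (γ : ℝ) (x : ℝ) : ℝ := if x < 0 then Real.exp (-((-x) ^ γ)) else 1

/-- Generalized inverse `F⁻¹(u) = inf {x | F x ≥ u}`. -/
def genInv (F : ℝ → ℝ) (u : ℝ) : ℝ := sInf {x | u ≤ F x}

/-- Upper endpoint `x₀(F) = sup {x | F x < 1}`. -/
def upEnd (F : ℝ → ℝ) : ℝ := sSup {x | F x < 1}

/-- Membership in `D(φ) = ⋃_{γ>0} D(φ_γ)`. -/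
def MemFrechetDom (F : ℝ → ℝ) : Prop := ∃ γ, 0 < γ ∧ MemDomAttr F (frechetDF γ)

/-- Membership in `D(ψ) = ⋃_{γ>0} D(ψ_γ)`. -/
def MemWeibullDom (F : ℝ → ℝ) : Prop := ∃ γ, 0 < γ ∧ MemDomAttr F (weibullDF γ)

/-- Membership in `Γ = D(Λ) ∪ D(φ) ∪ D(ψ)`. -/
def MemGamma (F : ℝ → ℝ) : Prop :=
  MemDomAttr F gumbelDF ∨ MemFrechetDom F ∨ MemWeibullDom F

/-- Iterated integral `x ↦ ∫_x^z dy_1 ∫_{y_1}^z ⋯ ∫_{y_p}^z (1 - H t) dt`. -/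
def iterInt (H : ℝ → ℝ) (z : ℝ) : ℕ → ℝ → ℝ
  | 0 => fun x => ∫ t in x..z, (1 - H t)
  | (p + 1) => fun x => ∫ y in x..z, iterInt H z p y

/-- `Rp p x z H` is `R_p(x, z, H)` (for `p ≥ 1`). -/
def Rp (p : ℕ) (x z : ℝ) (H : ℝ → ℝ) : ℝ := (1 - H x)⁻¹ * iterInt H z (p - 1) x

/-- Iterated integral with upper endpoint `x₀(H)` (handled as an integral up to +∞,
since `1 - H` vanishes beyond the upper endpoint). -/
def iterIntInf (H : ℝ → ℝ) : ℕ → ℝ → ℝ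
  | 0 => fun x => ∫ t in Set.Ioi x, (1 - H t)
  | (p + 1) => fun x => ∫ y in Set.Ioi x, iterIntInf H p y

/-- `RpInf p x H` is `R_p(x, H) = R_p(x, x₀(H), H)` (for `p ≥ 1`). -/
def RpInf (p : ℕ) (x : ℝ) (H : ℝ → ℝ) : ℝ := (1 - H x)⁻¹ * iterIntInf H (p - 1) x

/-- Regular variation at zero with exponent `d`. -/
def RegVarAtZero (s : ℝ → ℝ) (d : ℝ) : Prop :=
  ∀ l : ℝ, 0 < l → Tendsto (fun u => s (l * u) / s u) (𝓝[>] (0 : ℝ)) (𝓝 (l ^ d))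

/-- `orderStat n j v`: the `j`-th smallest (1-indexed) among `v 0, …, v (n-1)`. -/
def orderStat (n j : ℕ) (v : ℕ → ℝ) : ℝ :=
  ((Multiset.map v (Multiset.range n)).sort (· ≤ ·)).getD (j - 1) 0

/-- Cumulative distribution function of the centered Gaussian law with variance `v`. -/
def gaussCdf (v : ℝ) (x : ℝ) : ℝ :=
  ((ProbabilityTheory.gaussianReal 0 v.toNNReal) (Set.Iic x)).toReal


open Classical in
/-- The filter "x → x₀(G)⁻" of approach to the upper endpoint from below
(`atTop` when the upper endpoint is infinite). -/
def upEndFilter (G : ℝ → ℝ) : Filter ℝ :=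
  if BddAbove {x | G x < 1} then 𝓝[<] (upEnd G) else atTop


lemma aux_tail_lim (y : ℕ → ℝ) (h0 : ∀ n, 0 ≤ y n) (m : ℝ) (hm : 0 < m)
    (h : Tendsto (fun n => y n ^ n) atTop (𝓝 m)) :
    Tendsto (fun n : ℕ => (n : ℝ) * (1 - y n)) atTop (𝓝 (-Real.log m)) := by
  have hlog : Tendsto (fun n : ℕ => (n : ℝ) * Real.log (y n)) atTop (𝓝 (Real.log m)) := by
    have := (Real.continuousAt_log hm.ne').tendsto.comp h
    refine this.congr fun n => ?_
    simp [Function.comp, Real.log_pow]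
  have hpos : ∀ᶠ n in atTop, 0 < y n := by
    filter_upwards [h.eventually (lt_mem_nhds hm), eventually_ge_atTop 1] with n hn hn1
    rcases (h0 n).lt_or_eq with h | h
    · exact h
    · rw [← h, zero_pow (by omega)] at hn
      exact absurd hn (lt_irrefl _)
  have hl0 : Tendsto (fun n : ℕ => Real.log (y n)) atTop (𝓝 0) := by
    have h2 := hlog.mul (tendsto_inv_atTop_nhds_zero_nat (𝕜 := ℝ))
    rw [mul_zero] at h2
    refine h2.congr' ?_
    filter_upwards [eventually_ge_atTop 1] with n hn
    have : (n : ℝ) ≠ 0 := by positivity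
    field_simp
  have hy1 : Tendsto y atTop (𝓝 1) := by
    have h2 := (Real.continuous_exp.tendsto 0).comp hl0
    rw [Real.exp_zero] at h2
    refine h2.congr' ?_
    filter_upwards [hpos] with n hn
    simp [Function.comp, Real.exp_log hn]
  have hlow := hy1.mul hlog.neg
  rw [one_mul] at hlow
  refine tendsto_of_tendsto_of_tendsto_of_le_of_le' hlow hlog.neg ?_ ?_
  · filter_upwards [hpos] with n hn
    have h3 := Real.one_sub_inv_le_log_of_pos hn
    have h4 : y n * (-Real.log (y n)) ≤ 1 - y n := by
      have : y n * (1 - (y n)⁻¹) ≤ y n * Real.log (y n) := by gcongr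
      rw [mul_sub, mul_inv_cancel₀ hn.ne'] at this
      linarith
    have := mul_le_mul_of_nonneg_left h4 (Nat.cast_nonneg (α := ℝ) n)
    linarith
  · filter_upwards [hpos] with n hn
    have h3 := Real.log_le_sub_one_of_pos hn
    have := mul_le_mul_of_nonneg_left h3 (Nat.cast_nonneg (α := ℝ) n)
    linarith

lemma aux_floor_top : Tendsto (fun u : ℝ => ⌊u⁻¹⌋₊) (𝓝[>] 0) atTop :=
  tendsto_nat_floor_atTop.comp tendsto_inv_nhdsGT_zero

lemma aux_floor_mul : Tendsto (fun u : ℝ => (⌊u⁻¹⌋₊ : ℝ) * u) (𝓝[>] 0) (𝓝 1) := by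
  have := (tendsto_nat_floor_div_atTop (R := ℝ)).comp tendsto_inv_nhdsGT_zero
  refine this.congr fun u => ?_
  simp [Function.comp]

lemma aux_le_one {F : ℝ → ℝ} (hF : IsDF F) (x : ℝ) : F x ≤ 1 :=
  hF.1.ge_of_tendsto hF.2.2.2 x

lemma aux_nonneg {F : ℝ → ℝ} (hF : IsDF F) (x : ℝ) : 0 ≤ F x :=
  hF.1.le_of_tendsto hF.2.2.1 x

lemma aux_tail_u {F M : ℝ → ℝ} (hF : IsDF F) (a b : ℕ → ℝ)
    (x : ℝ) (hM : 0 < M x)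
    (h : Tendsto (fun n => F (a n * x + b n) ^ n) atTop (𝓝 (M x))) :
    Tendsto (fun u : ℝ => (1 - F (a ⌊u⁻¹⌋₊ * x + b ⌊u⁻¹⌋₊)) / u) (𝓝[>] 0)
      (𝓝 (-Real.log (M x))) := by
  have h1 := aux_tail_lim (fun n => F (a n * x + b n)) (fun n => aux_nonneg hF _) (M x) hM h
  have h2 := (h1.comp aux_floor_top).div aux_floor_mul one_ne_zero
  rw [div_one] at h2
  refine h2.congr' ?_
  filter_upwards [self_mem_nhdsWithin, aux_floor_mul.eventually (lt_mem_nhds one_pos)] with u hu hu1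
  have hu0 : u ≠ 0 := (show (0:ℝ) < u from hu).ne'
  have : (⌊u⁻¹⌋₊ : ℝ) ≠ 0 := by
    intro h; rw [h] at hu1; simp at hu1
  change (⌊u⁻¹⌋₊ : ℝ) * (1 - F (a ⌊u⁻¹⌋₊ * x + b ⌊u⁻¹⌋₊)) / ((⌊u⁻¹⌋₊ : ℝ) * u) = _
  rw [mul_div_mul_left _ _ this]

lemma aux_gal {F : ℝ → ℝ} (hF : IsDF F) (hF1 : F 1 = 0) {u : ℝ} (hu : 0 < u) (hu1 : u < 1)
    (y : ℝ) : genInv F (1 - u) ≤ y ↔ 1 - u ≤ F y := by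
  have hlb : ∀ x ∈ {x | 1 - u ≤ F x}, 1 ≤ x := by
    intro x hx
    by_contra hlt
    have := hF.1 (not_le.1 hlt).le
    rw [hF1] at this
    have hx' : 1 - u ≤ F x := hx
    linarith
  have hbdd : BddBelow {x | 1 - u ≤ F x} := ⟨1, hlb⟩
  have hne : {x | 1 - u ≤ F x}.Nonempty := by
    obtain ⟨x, hx⟩ := (hF.2.2.2.eventually (lt_mem_nhds (show 1 - u < 1 by linarith))).exists
    exact ⟨x, hx.le⟩
  constructor
  · intro h
    refine le_trans ?_ (hF.1 h)
    set v := genInv F (1 - u) with hv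
    have hc := (hF.2.1 v).mono_left (nhdsWithin_mono v Ioi_subset_Ici_self)
    refine ge_of_tendsto hc ?_
    filter_upwards [self_mem_nhdsWithin] with z hz
    obtain ⟨w, hw, hwz⟩ := exists_lt_of_csInf_lt hne (show sInf {x | 1 - u ≤ F x} < z from hz)
    exact le_trans hw (hF.1 hwz.le)
  · intro h
    exact csInf_le hbdd h

lemma aux_one_le {F : ℝ → ℝ} (hF : IsDF F) (hF1 : F 1 = 0) {u : ℝ} (hu : 0 < u) (hu1 : u < 1) :
    1 ≤ genInv F (1 - u) := by
  by_contra h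
  have := (aux_gal hF hF1 hu hu1 1).1 (not_le.1 h).le
  rw [hF1] at this; linarith

lemma aux_gal_log {F : ℝ → ℝ} (hF : IsDF F) (hF1 : F 1 = 0) {u : ℝ} (hu : 0 < u) (hu1 : u < 1) :
    genInv (fun x => F (Real.exp x)) (1 - u) = Real.log (genInv F (1 - u)) := by
  have h1 := aux_one_le hF hF1 hu hu1
  have : {x | 1 - u ≤ F (Real.exp x)} = Ici (Real.log (genInv F (1 - u))) := by
    ext x
    simp only [mem_ofPred_eq, mem_Ici]
    rw [← aux_gal hF hF1 hu hu1, Real.log_le_iff_le_exp (by linarith)]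
  rw [genInv, this, csInf_Ici]

lemma aux_inv {F : ℝ → ℝ} (hF : IsDF F) (hF1 : F 1 = 0) (A B : ℝ → ℝ) (hA : ∀ u, 0 < A u)
    (I : Set ℝ) (hI : IsOpen I) (τ : ℝ → ℝ) (hτ : StrictAntiOn τ I)
    (h : ∀ x ∈ I, Tendsto (fun u => (1 - F (A u * x + B u)) / u) (𝓝[>] 0) (𝓝 (τ x)))
    (s q : ℝ) (hs : 0 < s) (hq : q ∈ I) (hqs : τ q = s) :
    Tendsto (fun u => (genInv F (1 - s * u) - B u) / A u) (𝓝[>] 0) (𝓝 q) := by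
  have hsm : ∀ᶠ u : ℝ in 𝓝[>] 0, u < s⁻¹ := by
    refine nhdsWithin_le_nhds (gt_mem_nhds (by positivity))
  have hb : ∀ y, q < y → ∃ x ∈ I, q < x ∧ x < y := by
    intro y hy
    obtain ⟨z, hz, hz2⟩ := exists_Ico_subset_of_mem_nhds (hI.mem_nhds hq) ⟨y, hy⟩
    obtain ⟨x, hx1, hx2⟩ := exists_between (lt_min hz hy)
    exact ⟨x, hz2 ⟨hx1.le, hx2.trans_le (min_le_left _ _)⟩, hx1, hx2.trans_le (min_le_right _ _)⟩
  have hb' : ∀ y, y < q → ∃ x ∈ I, x < q ∧ y < x := by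
    intro y hy
    obtain ⟨z, hz, hz2⟩ := exists_Ioc_subset_of_mem_nhds (hI.mem_nhds hq) ⟨y, hy⟩
    obtain ⟨x, hx1, hx2⟩ := exists_between (max_lt hz hy)
    exact ⟨x, hz2 ⟨(le_max_left _ _).trans_lt hx1, hx2.le⟩, hx2, (le_max_right _ _).trans_lt hx1⟩
  refine tendsto_order.2 ⟨fun y hy => ?_, fun y hy => ?_⟩
  · obtain ⟨x, hxI, hxq, hyx⟩ := hb' y hy
    have := hτ hxI hq hxq
    rw [hqs] at this
    filter_upwards [(h x hxI).eventually (lt_mem_nhds this), self_mem_nhdsWithin, hsm]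
      with u hu hu0 hus
    have hu0 : 0 < u := hu0
    refine hyx.trans ?_
    rw [lt_div_iff₀ hu0] at hu
    rw [lt_div_iff₀ (hA u)]
    have hsu : s * u < 1 := by
      rw [← mul_inv_cancel₀ hs.ne']; gcongr
    have := mt (aux_gal hF hF1 (by positivity) hsu (A u * x + B u)).1 (by linarith)
    linarith
  · obtain ⟨x, hxI, hxq, hyx⟩ := hb y hy
    have := hτ hq hxI hxq
    rw [hqs] at this
    filter_upwards [(h x hxI).eventually (gt_mem_nhds this), self_mem_nhdsWithin, hsm]
      with u hu hu0 hus
    have hu0 : 0 < u := hu0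
    refine lt_of_le_of_lt ?_ hyx
    rw [div_lt_iff₀ hu0] at hu
    rw [div_le_iff₀ (hA u)]
    have hsu : s * u < 1 := by
      rw [← mul_inv_cancel₀ hs.ne']; gcongr
    have := (aux_gal hF hF1 (by positivity) hsu (A u * x + B u)).2 (by linarith)
    linarith

lemma aux_scale {l : ℝ} (hl : 0 < l) : Tendsto (fun u : ℝ => l * u) (𝓝[>] 0) (𝓝[>] 0) := by
  refine tendsto_nhdsWithin_iff.2 ⟨?_, ?_⟩
  · have : Tendsto (fun u : ℝ => l * u) (𝓝 0) (𝓝 (l * 0)) := by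
      exact (continuous_const.mul continuous_id).tendsto 0
    rw [mul_zero] at this
    exact this.mono_left nhdsWithin_le_nhds
  · filter_upwards [self_mem_nhdsWithin] with u hu
    exact mul_pos hl hu

lemma aux_lt {c : ℝ} (hc : 0 < c) : ∀ᶠ u : ℝ in 𝓝[>] 0, u < c :=
  nhdsWithin_le_nhds (gt_mem_nhds hc)

lemma aux_log (α k : ℝ → ℝ) (κ : ℝ) (hα : Tendsto α (𝓝[>] 0) (𝓝 0))
    (hα0 : ∀ᶠ u in 𝓝[>] 0, 0 < α u)
    (hk : Tendsto k (𝓝[>] 0) (𝓝 κ)) :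
    Tendsto (fun u => Real.log (1 + α u * k u) / α u) (𝓝[>] 0) (𝓝 κ) := by
  have h1 : Tendsto (fun u => 1 + α u * k u) (𝓝[>] 0) (𝓝 1) := by
    have := (hα.mul hk).const_add 1
    simpa using this
  have hd : ContinuousAt (dslope Real.log 1) 1 :=
    continuousAt_dslope_same.2 (Real.differentiableAt_log one_ne_zero)
  have h2 := (hd.tendsto.comp h1).mul hk
  rw [dslope_same, Real.deriv_log, inv_one, one_mul] at h2
  refine h2.congr' ?_
  filter_upwards [hα0] with u hu
  have := sub_smul_dslope Real.log 1 (1 + α u * k u)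
  rw [Real.log_one, sub_zero, smul_eq_mul] at this
  rw [← this, Function.comp]
  field_simp
  ring

lemma aux_anti {G W : ℝ → ℝ} (gal : ∀ u, 0 < u → u < 1 → ∀ t, W u ≤ t ↔ 1 - u ≤ G t) :
    AntitoneOn W (Ioo 0 1) := by
  intro v hv u hu hvu
  rw [gal u hu.1 hu.2]
  have := (gal v hv.1 hv.2 (W v)).1 le_rfl
  linarith

lemma aux_int {G W : ℝ → ℝ} (hG : Monotone G) (hG1 : ∀ x, G x ≤ 1)
    (gal : ∀ u, 0 < u → u < 1 → ∀ t, W u ≤ t ↔ 1 - u ≤ G t) {u : ℝ} (hu : 0 < u) (hu1 : u < 1) :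
    ∫ t in Ioi (W u), (1 - G t) = u * ∫ s in Ioc (0:ℝ) 1, (W (s * u) - W u) := by
  have hanti := aux_anti gal
  have hmeas : AEMeasurable (fun t => 1 - G t) (volume.restrict (Ioi (W u))) :=
    (measurable_const.sub hG.measurable).aemeasurable
  have hnn : 0 ≤ᵐ[volume.restrict (Ioi (W u))] fun t => 1 - G t :=
    Eventually.of_forall fun t => sub_nonneg.2 (hG1 t)
  have hL : ∫⁻ t in Ioi (W u), ENNReal.ofReal (1 - G t)
      = ∫⁻ v in Ioo 0 u, ENNReal.ofReal (W v - W u) := by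
    rw [lintegral_eq_lintegral_meas_lt _ hnn hmeas]
    have h1 : ∀ v ∈ Ioi (0:ℝ), (volume.restrict (Ioi (W u))) {t | v < 1 - G t}
        = (Ioo 0 u).indicator (fun v => ENNReal.ofReal (W v - W u)) v := by
      intro v hv
      have hv : 0 < v := hv
      rw [Measure.restrict_apply' measurableSet_Ioi]
      by_cases hvu : v < u
      · rw [indicator_of_mem (show v ∈ Ioo 0 u from ⟨hv, hvu⟩)]
        have : {t | v < 1 - G t} ∩ Ioi (W u) = Ioo (W u) (W v) := by
          ext t
          simp only [mem_inter_iff, mem_ofPred_eq, mem_Ioi, mem_Ioo]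
          have := gal v hv (hvu.trans hu1) t
          rw [← not_le (a := W v), this]
          constructor
          · rintro ⟨h1, h2⟩; exact ⟨h2, fun h => by linarith⟩
          · rintro ⟨h1, h2⟩; exact ⟨by linarith [not_le.1 h2], h1⟩
        rw [this, Real.volume_Ioo]
      · rw [indicator_of_notMem (fun h : v ∈ Ioo 0 u => hvu h.2)]
        have : {t | v < 1 - G t} ∩ Ioi (W u) = ∅ := by
          ext t
          simp only [mem_inter_iff, mem_ofPred_eq, mem_Ioi, mem_empty_iff_false, iff_false]
          rintro ⟨h1, h2⟩
          have := (gal u hu hu1 t).1 h2.le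
          linarith
        rw [this, measure_empty]
    rw [setLIntegral_congr_fun measurableSet_Ioi h1, setLIntegral_indicator measurableSet_Ioo]
    congr 2
    rw [inter_eq_left.2 (fun x hx => hx.1)]
  have hsub : Ioo 0 u ⊆ Ioo (0:ℝ) 1 := Ioo_subset_Ioo_right hu1.le
  have hR : ∫ t in Ioi (W u), (1 - G t) = ∫ v in Ioo 0 u, (W v - W u) := by
    rw [integral_eq_lintegral_of_nonneg_ae hnn hmeas.aestronglyMeasurable,
      integral_eq_lintegral_of_nonneg_ae, hL]
    · filter_upwards [ae_restrict_mem measurableSet_Ioo] with v hv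
      exact sub_nonneg.2 (hanti (hsub hv) ⟨hu, hu1⟩ hv.2.le)
    · exact ((aemeasurable_restrict_of_antitoneOn measurableSet_Ioo
        (hanti.mono hsub)).sub_const _).aestronglyMeasurable
  rw [hR, ← integral_Ioc_eq_integral_Ioo, ← intervalIntegral.integral_of_le hu.le,
    ← intervalIntegral.integral_of_le zero_le_one]
  have := intervalIntegral.mul_integral_comp_mul_right (a := 0) (b := 1)
    (f := fun v => W v - W u) u
  rw [this]; simp

lemma aux_dyadic (W : ℝ → ℝ) (u0 : ℝ) 
    (h4 : ∀ u, 0 < u → u ≤ u0 → W (u / 16) - W (u / 4) ≤ 2 * (W (u / 4) - W u)) (n : ℕ) :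
    ∀ u, 0 < u → u ≤ u0 → W (u / 4 ^ n) - W u ≤ (2 ^ n - 1) * (W (u / 4) - W u) := by
  induction n with
  | zero => intro u _ _; simp
  | succ n ih =>
    intro u hu huu
    have h1 := ih (u / 4) (by positivity) (by linarith)
    have h2 := h4 u hu huu
    rw [show u / 4 / 4 ^ n = u / 4 ^ (n + 1) by rw [pow_succ]; field_simp,
      show u / 4 / 4 = u / 16 by ring] at h1
    have h3 : (0:ℝ) ≤ 2 ^ n - 1 := by
      have := one_le_pow₀ (show (1:ℝ) ≤ 2 by norm_num) (n := n)
      linarith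
    have := mul_le_mul_of_nonneg_left h2 h3
    have h5 : (2:ℝ) ^ (n + 1) = 2 ^ n * 2 := pow_succ _ _
    rw [h5]
    linarith

lemma aux_dyadic2 (W : ℝ → ℝ) (u0 : ℝ) (hu1 : u0 < 1) (hW : AntitoneOn W (Ioo 0 1))
    (h4 : ∀ u, 0 < u → u ≤ u0 → W (u / 16) - W (u / 4) ≤ 2 * (W (u / 4) - W u)) 
    (u : ℝ) (hu : 0 < u) (huu : u ≤ u0) (s : ℝ) (hs : 0 < s) (hs1 : s ≤ 1) :
    W (s * u) - W u ≤ 2 * s ^ (-(1/2) : ℝ) * (W (u / 4) - W u) := by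
  obtain ⟨n, hn1, hn2⟩ := exists_nat_pow_near ((one_le_inv₀ hs).2 hs1) (show (1:ℝ) < 4 by norm_num)
  have h0 : 0 ≤ W (u / 4) - W u :=
    sub_nonneg.2 (hW ⟨by positivity, by linarith⟩ ⟨hu, by linarith⟩ (by linarith))
  have h1 := aux_dyadic W u0 h4 (n + 1) u hu huu
  have h2 : W (s * u) ≤ W (u / 4 ^ (n + 1)) := by
    have hp : (1:ℝ) ≤ 4 ^ (n+1) := one_le_pow₀ (by norm_num)
    have h3 : u / 4 ^ (n+1) ≤ s * u := by
      rw [div_le_iff₀ (by positivity)]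
      rw [inv_lt_iff_one_lt_mul₀ hs] at hn2
      nlinarith
    have h5 : s * u ≤ u := by nlinarith
    exact hW ⟨by positivity, by linarith⟩ ⟨by positivity, by linarith⟩ h3
  have h3 : (2:ℝ) ^ n ≤ s ^ (-(1/2) : ℝ) := by
    rw [Real.rpow_neg hs.le, ← Real.inv_rpow hs.le, ← Real.sqrt_eq_rpow]
    apply Real.le_sqrt_of_sq_le
    calc ((2:ℝ)^n)^2 = 4 ^ n := by rw [← pow_mul, mul_comm, pow_mul]; norm_num
      _ ≤ _ := hn1
  calc W (s * u) - W u ≤ (2 ^ (n+1) - 1) * (W (u / 4) - W u) := by linarith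
    _ ≤ 2 * s ^ (-(1/2) : ℝ) * (W (u / 4) - W u) := by
      gcongr
      rw [pow_succ]; linarith

lemma aux_ratio (W D k : ℝ → ℝ) (hD : ∀ᶠ u in 𝓝[>] 0, 0 < D u)
    (hk : ∀ s, 0 < s → Tendsto (fun u => (W (s * u) - W u) / D u) (𝓝[>] 0) (𝓝 (k s)))
    (hk4 : k (1 / 4) ≠ 0) (l : ℝ) (hl : 0 < l) (ρ : ℝ)
    (hkd : k (l / 4) - k l = ρ * k (1 / 4)) :
    Tendsto (fun u => D (l * u) / D u) (𝓝[>] 0) (𝓝 ρ) := by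
  have h1 := (hk (l / 4) (by positivity)).sub (hk l hl)
  rw [hkd] at h1
  have h2 := (hk (1/4) (by norm_num)).comp (aux_scale hl)
  have h3 := h1.div h2 hk4
  rw [mul_div_cancel_right₀ _ hk4] at h3
  refine h3.congr' ?_
  filter_upwards [hD, (aux_scale hl).eventually hD, h2.eventually (isOpen_ne.mem_nhds hk4)]
    with u hu hu2 hu3
  simp only [Function.comp_def] at hu3
  have h4 : W (1 / 4 * (l * u)) - W (l * u) ≠ 0 := by
    intro h; rw [h, zero_div] at hu3; exact hu3 rfl
  change ((W (l / 4 * u) - W u) / D u - (W (l * u) - W u) / D u) /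
    ((W (1 / 4 * (l * u)) - W (l * u)) / D (l * u)) = _
  rw [show l / 4 * u = 1 / 4 * (l * u) by ring]
  rw [← sub_div, sub_sub_sub_cancel_right]
  generalize W (1 / 4 * (l * u)) - W (l * u) = z at h4
  field_simp

lemma aux_main {G W : ℝ → ℝ} (hG : Monotone G) (hG1 : ∀ x, G x ≤ 1)
    (gal : ∀ u, 0 < u → u < 1 → ∀ t, W u ≤ t ↔ 1 - u ≤ G t)
    (D k : ℝ → ℝ) (d : ℝ) (hd : 0 ≤ d) (hD : ∀ᶠ u in 𝓝[>] 0, 0 < D u)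
    (hk : ∀ s, 0 < s → Tendsto (fun u => (W (s * u) - W u) / D u) (𝓝[>] 0) (𝓝 (k s)))
    (hkpos : ∀ s, 0 < s → s < 1 → 0 < k s)
    (hkd : ∀ l, 0 < l → k (l / 4) - k l = l ^ d * k (1 / 4))
    (hkint : IntegrableOn k (Ioc 0 1)) :
    RegVarAtZero (fun u => (1 - G (W u))⁻¹ * ∫ t in Ioi (W u), (1 - G t)) d := by
  have hanti := aux_anti gal
  have hk4 := hkpos (1/4) (by norm_num) (by norm_num)
  -- variation of D
  have hDvar : ∀ l, 0 < l → Tendsto (fun u => D (l * u) / D u) (𝓝[>] 0) (𝓝 (l ^ d)) :=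
    fun l hl => aux_ratio W D k hD hk hk4.ne' l hl _ (hkd l hl)
  -- u / g(W u) → 1
  have hp : Tendsto (fun u => (1 - G (W u)) / u) (𝓝[>] 0) (𝓝 1) := by
    refine tendsto_order.2 ⟨fun y hy => ?_, fun y hy => ?_⟩
    · obtain ⟨q, hq1, hq2⟩ := exists_between (max_lt hy (show (0:ℝ) < 1 by norm_num))
      have hq0 : 0 < q := (le_max_right _ _).trans_lt hq1
      filter_upwards [(hk q hq0).eventually (lt_mem_nhds (hkpos q hq0 hq2)), hD,
        self_mem_nhdsWithin, aux_lt one_pos] with u h1 h2 h3 h4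
      have h3 : 0 < u := h3
      rw [lt_div_iff₀ h3]
      have h5 : W u < W (q * u) := by
        have := (div_pos_iff_of_pos_right h2).1 h1
        linarith
      have h6 := mt (gal (q * u) (by positivity) (by nlinarith) (W u)).2 (not_le.2 h5)
      have : y < q := (le_max_left _ _).trans_lt hq1
      nlinarith
    · filter_upwards [self_mem_nhdsWithin, aux_lt one_pos] with u h3 h4
      have h3 : 0 < u := h3
      refine lt_of_le_of_lt ?_ hy
      rw [div_le_one h3]
      have := (gal u h3 h4 (W u)).1 le_rfl
      linarith
  -- eventual growth bounds
  have hgrow : ∀ᶠ u in 𝓝[>] 0, W (u / 16) - W (u / 4) ≤ 2 * (W (u / 4) - W u) := by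
    have h1 := ((hk (1/4) (by norm_num)).const_mul 3).sub (hk (1/16) (by norm_num))
    have h2 : 0 < 3 * k (1/4) - k (1/16) := by
      have h3 := hkd (1/4) (by norm_num)
      have h4 : ((1:ℝ)/4) ^ d ≤ 1 := Real.rpow_le_one (by norm_num) (by norm_num) hd
      rw [show (1:ℝ)/4/4 = 1/16 by norm_num] at h3
      nlinarith
    filter_upwards [h1.eventually (lt_mem_nhds h2), hD] with u h3 h4
    have h5 : 0 < (3 * (W (1/4 * u) - W u) - (W (1/16 * u) - W u)) / D u := by
      rw [sub_div, mul_div_assoc]; exact h3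
    have := (div_pos_iff_of_pos_right h4).1 h5
    rw [show 1/4 * u = u / 4 by ring, show 1/16 * u = u / 16 by ring] at this
    linarith
  obtain ⟨w, hw, hgw⟩ := mem_nhdsGT_iff_exists_Ioc_subset.1 hgrow
  have hw : 0 < w := hw
  have hlim : Tendsto (fun u => ∫ s in Ioc (0:ℝ) 1, (W (s * u) - W u) / D u) (𝓝[>] 0)
      (𝓝 (∫ s in Ioc (0:ℝ) 1, k s)) := by
    have h1 := (hk (1/4) (by norm_num)).eventually
      (gt_mem_nhds (show k (1/4) < 2 * k (1/4) by linarith))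
    refine tendsto_integral_filter_of_dominated_convergence
      (fun s => 2 * s ^ (-(1/2) : ℝ) * (2 * k (1/4))) ?_ ?_ ?_ ?_
    · filter_upwards [self_mem_nhdsWithin, aux_lt one_pos] with u hu hu1
      have hu : 0 < u := hu
      have h2 : AntitoneOn (fun s => W (s * u)) (Ioc 0 1) := by
        intro x hx y hy hxy
        exact hanti ⟨mul_pos hx.1 hu, by nlinarith [hx.2]⟩ ⟨mul_pos hy.1 hu, by nlinarith [hy.2]⟩
          (by gcongr)
      exact (((aemeasurable_restrict_of_antitoneOn measurableSet_Ioc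
        h2).sub_const _).div_const _).aestronglyMeasurable
    · filter_upwards [self_mem_nhdsWithin, aux_lt (show (0:ℝ) < min w (1/2) by positivity), hD, h1]
        with u hu hu1 hDu h1u
      have hu : 0 < u := hu
      have hu2 : u < 1/2 := hu1.trans_le (min_le_right _ _)
      filter_upwards [ae_restrict_mem measurableSet_Ioc] with s hs
      have h3 := aux_dyadic2 W (min w (1/2)) ((min_le_right _ _).trans_lt (by norm_num)) hanti
        (fun v hv hvw => hgw ⟨hv, hvw.trans (min_le_left _ _)⟩) u hu hu1.le s hs.1 hs.2
      have h4 : 0 ≤ W (s * u) - W u :=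
        sub_nonneg.2 (hanti ⟨mul_pos hs.1 hu, by nlinarith [hs.2]⟩ ⟨hu, by linarith⟩
          (by nlinarith [hs.2]))
      rw [Real.norm_of_nonneg (by positivity), div_le_iff₀ hDu]
      rw [div_lt_iff₀ hDu, show 1/4 * u = u / 4 by ring] at h1u
      refine h3.trans ?_
      rw [mul_assoc _ (2 * k (1/4))]
      have : 0 < s := hs.1
      gcongr
    · have h2 := intervalIntegral.intervalIntegrable_rpow' (a := 0) (b := 1)
        (show (-1:ℝ) < -(1/2) by norm_num)
      rw [intervalIntegrable_iff_integrableOn_Ioc_of_le zero_le_one] at h2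
      exact (h2.const_mul 2).mul_const _
    · filter_upwards [ae_restrict_mem measurableSet_Ioc] with s hs
      exact hk s hs.1
  have hc : 0 < ∫ s in Ioc (0:ℝ) 1, k s := by
    rw [integral_Ioc_eq_integral_Ioo]
    rw [setIntegral_pos_iff_support_of_nonneg_ae]
    · have : Ioo (0:ℝ) 1 ⊆ Function.support k ∩ Ioo 0 1 :=
        fun x hx => ⟨(hkpos x hx.1 hx.2).ne', hx⟩
      refine lt_of_lt_of_le ?_ (measure_mono this)
      simp
    · filter_upwards [ae_restrict_mem measurableSet_Ioo] with s hs
      exact (hkpos s hs.1 hs.2).le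
    · exact hkint.mono_set Ioo_subset_Ioc_self
  set c := ∫ s in Ioc (0:ℝ) 1, k s with hcdef
  set r := fun u => (1 - G (W u))⁻¹ * ∫ t in Ioi (W u), (1 - G t) with hr
  have hrD : Tendsto (fun u => r u / D u) (𝓝[>] 0) (𝓝 c) := by
    have h1 := (hp.inv₀ one_ne_zero).mul hlim
    rw [inv_one, one_mul] at h1
    refine h1.congr' ?_
    filter_upwards [self_mem_nhdsWithin, aux_lt one_pos] with u hu hu1
    rw [hr]
    simp only
    rw [aux_int hG hG1 gal hu hu1, integral_div, inv_div]
    ring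
  intro l hl
  have h1 := ((hrD.comp (aux_scale hl)).mul (hDvar l hl)).div hrD hc.ne'
  rw [mul_div_cancel_left₀ _ hc.ne'] at h1
  refine h1.congr' ?_
  filter_upwards [hD, (aux_scale hl).eventually hD] with u hu hu2
  change r (l * u) / D (l * u) * (D (l * u) / D u) / (r u / D u) = _
  field_simp

lemma aux_contr (e : ℝ → ℝ) (he : ∀ u, 0 ≤ e u) (θ : ℝ) (hθ0 : 0 ≤ θ) (hθ1 : θ < 1)
    (h : ∀ ε, 0 < ε → ∀ᶠ u in 𝓝[>] (0:ℝ), e (1 / 2 * u) ≤ θ * e u + ε)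
    (hB : ∀ m, 0 < m → ∃ B, ∀ u, m ≤ u → u ≤ 1 / 2 → e u ≤ B) :
    Tendsto e (𝓝[>] 0) (𝓝 0) := by
  refine tendsto_order.2 ⟨fun y hy => Eventually.of_forall fun u => hy.trans_le (he u),
    fun η hη => ?_⟩
  obtain ⟨w', hw', hgw⟩ := mem_nhdsGT_iff_exists_Ioc_subset.1
    (h ((1 - θ) * (η / 2)) (mul_pos (by linarith) (by positivity)))
  have hw' : 0 < w' := hw'
  set w := min w' (1/2) with hwdef
  have hw : 0 < w := by positivity
  obtain ⟨B, hB⟩ := hB (w / 2) (by positivity)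
  have hB0 : 0 ≤ B := (he w).trans (hB w (by linarith) (min_le_right _ _))
  have hit : ∀ n : ℕ, ∀ v, 0 < v → v ≤ w → e (v / 2 ^ n) - η / 2 ≤ θ ^ n * (e v - η / 2) := by
    intro n
    induction n with
    | zero => intro v _ _; simp
    | succ n ih =>
      intro v hv hvw
      have h1 := ih (1 / 2 * v) (by positivity) (by linarith)
      have h2 : e (1 / 2 * v) ≤ θ * e v + (1 - θ) * (η / 2) :=
        hgw ⟨hv, hvw.trans (min_le_left _ _)⟩
      rw [show 1 / 2 * v / 2 ^ n = v / 2 ^ (n + 1) by rw [pow_succ]; field_simp] at h1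
      have h3 : e (1 / 2 * v) - η / 2 ≤ θ * (e v - η / 2) := by linarith
      have h4 := mul_le_mul_of_nonneg_left h3 (pow_nonneg hθ0 n)
      have h5 : θ ^ (n + 1) = θ ^ n * θ := pow_succ _ _
      rw [h5]
      linarith
  have hlim : Tendsto (fun n : ℕ => θ ^ n * B) atTop (𝓝 0) := by
    have := (tendsto_pow_atTop_nhds_zero_of_lt_one hθ0 hθ1).mul_const B
    rwa [zero_mul] at this
  obtain ⟨K, hK⟩ := eventually_atTop.1 (hlim.eventually (gt_mem_nhds (half_pos hη)))
  filter_upwards [self_mem_nhdsWithin, aux_lt (show (0:ℝ) < w / 2 ^ K by positivity)] with u hu huK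
  have hu : 0 < u := hu
  rw [lt_div_iff₀ (by positivity)] at huK
  have h2K : (1:ℝ) ≤ 2 ^ K := one_le_pow₀ (by norm_num)
  obtain ⟨n, hn1, hn2⟩ := exists_nat_pow_near (x := w / u) (by rw [one_le_div hu]; nlinarith)
    (show (1:ℝ) < 2 by norm_num)
  rw [le_div_iff₀ hu] at hn1
  have hKn : K ≤ n := by
    have h1 : (2:ℝ) ^ K < 2 ^ (n + 1) := by
      refine lt_trans ?_ hn2
      rw [lt_div_iff₀ hu]; linarith
    have := (pow_lt_pow_iff_right₀ (show (1:ℝ) < 2 by norm_num)).1 h1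
    omega
  rw [div_lt_iff₀ hu, pow_succ] at hn2
  have h1 := hit n (2 ^ n * u) (by positivity) hn1
  rw [mul_div_cancel_left₀ _ (by positivity)] at h1
  have h2 := hB (2 ^ n * u) (by linarith) (hn1.trans (min_le_right _ _))
  have h3 : θ ^ n * (e (2 ^ n * u) - η / 2) ≤ θ ^ n * B := by
    gcongr
    linarith
  have := hK n hKn
  linarith

lemma aux_bdd (a : ℕ → ℝ) (ha : ∀ n, 0 ≤ a n) (m : ℝ) (hm : 0 < m) :
    ∃ B, ∀ u, m ≤ u → a ⌊u⁻¹⌋₊ ≤ B := by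
  refine ⟨∑ i ∈ Finset.range (⌊m⁻¹⌋₊ + 1), a i, fun u hu => ?_⟩
  refine Finset.single_le_sum (f := a) (fun i _ => ha i) ?_
  rw [Finset.mem_range]
  have : ⌊u⁻¹⌋₊ ≤ ⌊m⁻¹⌋₊ := Nat.floor_mono (by gcongr)
  omega

lemma aux_gal_G {F : ℝ → ℝ} (hF : IsDF F) (hF1 : F 1 = 0) (u : ℝ) (hu : 0 < u) (hu1 : u < 1)
    (t : ℝ) : genInv (fun x => F (Real.exp x)) (1 - u) ≤ t ↔ 1 - u ≤ F (Real.exp t) := by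
  have h1 := aux_one_le hF hF1 hu hu1
  rw [aux_gal_log hF hF1 hu hu1, ← aux_gal hF hF1 hu hu1, Real.log_le_iff_le_exp (by linarith)]

lemma aux_ev {s : ℝ} (hs : 0 < s) : ∀ᶠ u : ℝ in 𝓝[>] 0, 0 < s * u ∧ s * u < 1 := by
  filter_upwards [self_mem_nhdsWithin, (aux_scale hs).eventually (aux_lt one_pos)] with u hu hu1
  exact ⟨mul_pos hs hu, hu1⟩

lemma aux_fin {F : ℝ → ℝ} (hF : IsDF F) (hF1 : F 1 = 0)
    (D k : ℝ → ℝ) (d : ℝ) (hd : 0 ≤ d) (hD : ∀ᶠ u in 𝓝[>] 0, 0 < D u)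
    (hk : ∀ s, 0 < s → Tendsto (fun u => (Real.log (genInv F (1 - s * u)) -
      Real.log (genInv F (1 - u))) / D u) (𝓝[>] 0) (𝓝 (k s)))
    (hkpos : ∀ s, 0 < s → s < 1 → 0 < k s)
    (hkd : ∀ l, 0 < l → k (l / 4) - k l = l ^ d * k (1 / 4))
    (hkint : IntegrableOn k (Ioc 0 1)) :
    RegVarAtZero (fun u => RpInf 1 (genInv (fun x => F (Real.exp x)) (1 - u))
      (fun x => F (Real.exp x))) d := by
  refine aux_main (G := fun x => F (Real.exp x))
    (W := fun u => genInv (fun x => F (Real.exp x)) (1 - u))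
    (fun x y h => hF.1 (Real.exp_le_exp.2 h)) (fun x => aux_le_one hF _)
    (fun u hu hu1 t => aux_gal_G hF hF1 u hu hu1 t) D k d hd hD (fun s hs => ?_) hkpos hkd hkint
  refine (hk s hs).congr' ?_
  filter_upwards [aux_ev hs, aux_ev one_pos] with u h1 h2
  rw [one_mul] at h2
  rw [aux_gal_log hF hF1 h1.1 h1.2, aux_gal_log hF hF1 h2.1 h2.2]

lemma aux_small {F : ℝ → ℝ} (hF : IsDF F) (hF1 : F 1 = 0) (A : ℝ → ℝ) (hA : ∀ u, 0 < A u)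
    (κ s : ℝ) (hs : 0 < s)
    (hα : Tendsto (fun u => A u / genInv F (1 - u)) (𝓝[>] 0) (𝓝 0))
    (hk : Tendsto (fun u => (genInv F (1 - s * u) - genInv F (1 - u)) / A u) (𝓝[>] 0) (𝓝 κ)) :
    Tendsto (fun u => (Real.log (genInv F (1 - s * u)) -
      Real.log (genInv F (1 - u))) / (A u / genInv F (1 - u))) (𝓝[>] 0) (𝓝 κ) := by
  have h1 := aux_log _ _ κ hα (by
    filter_upwards [aux_ev one_pos] with u h2
    rw [one_mul] at h2
    have := aux_one_le hF hF1 h2.1 h2.2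
    have := hA u
    positivity) hk
  refine h1.congr' ?_
  filter_upwards [aux_ev one_pos, aux_ev hs] with u h2 h3
  rw [one_mul] at h2
  have h4 := aux_one_le hF hF1 h2.1 h2.2
  have h5 := aux_one_le hF hF1 h3.1 h3.2
  have := hA u
  rw [← Real.log_div (by positivity) (by positivity)]
  congr 2
  field_simp
  ring

lemma aux_diff {F : ℝ → ℝ} (A B q : ℝ → ℝ)
    (h : ∀ s, 0 < s → Tendsto (fun u => (genInv F (1 - s * u) - B u) / A u) (𝓝[>] 0) (𝓝 (q s))) :
    ∀ s, 0 < s → Tendsto (fun u => (genInv F (1 - s * u) - genInv F (1 - u)) / A u) (𝓝[>] 0)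
      (𝓝 (q s - q 1)) := by
  intro s hs
  refine ((h s hs).sub (h 1 one_pos)).congr fun u => ?_
  rw [one_mul, ← sub_div]
  congr 1; ring

lemma aux_log_int (c : ℝ) : IntegrableOn (fun s => c * Real.log s) (Ioc 0 1) := by
  have h2 : IntervalIntegrable Real.log volume 0 1 := intervalIntegral.intervalIntegrable_log'
  rw [intervalIntegrable_iff_integrableOn_Ioc_of_le zero_le_one] at h2
  exact h2.const_mul c

lemma aux_gumbel {F : ℝ → ℝ} (hF : IsDF F) (hF1 : F 1 = 0) (h : MemDomAttr F gumbelDF) :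
    RegVarAtZero (fun u => RpInf 1 (genInv (fun x => F (Real.exp x)) (1 - u))
      (fun x => F (Real.exp x))) 0 := by
  obtain ⟨a, b, ha, hab⟩ := h
  have hA : ∀ u : ℝ, 0 < a ⌊u⁻¹⌋₊ := fun u => ha _
  have hinv : ∀ s, 0 < s → Tendsto (fun u => (genInv F (1 - s * u) - b ⌊u⁻¹⌋₊) / a ⌊u⁻¹⌋₊)
      (𝓝[>] 0) (𝓝 (-Real.log s)) := by
    intro s hs
    refine aux_inv hF hF1 (fun u => a ⌊u⁻¹⌋₊) (fun u => b ⌊u⁻¹⌋₊) hA univ isOpen_univ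
      (fun x => Real.exp (-x)) (fun x _ y _ hxy => Real.exp_lt_exp.2 (by linarith))
      (fun x _ => ?_) s _ hs trivial (by simp [Real.exp_log hs])
    have hM : 0 < gumbelDF x := Real.exp_pos _
    have h1 := aux_tail_u hF a b x hM (hab x (by unfold gumbelDF; fun_prop))
    simpa [gumbelDF] using h1
  have hd := aux_diff (F := F) _ _ _ hinv
  simp only [Real.log_one, neg_zero, sub_zero] at hd
  have hα : Tendsto (fun u => a ⌊u⁻¹⌋₊ / genInv F (1 - u)) (𝓝[>] 0) (𝓝 0) := by
    refine tendsto_order.2 ⟨fun y hy => ?_, fun ε hε => ?_⟩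
    · filter_upwards [aux_ev one_pos] with u h2
      rw [one_mul] at h2
      have := aux_one_le hF hF1 h2.1 h2.2
      have := hA u
      refine hy.trans (by positivity)
    · have h1 := hd (Real.exp (2 / ε)) (Real.exp_pos _)
      rw [Real.log_exp] at h1
      have h2 : -(2 / ε) < - (1 / ε) := by
        rw [neg_lt_neg_iff]; gcongr; norm_num
      filter_upwards [h1.eventually (gt_mem_nhds h2), aux_ev one_pos,
        aux_ev (Real.exp_pos (2 / ε))] with u h3 h4 h5
      rw [one_mul] at h4
      have h6 := aux_one_le hF hF1 h4.1 h4.2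
      have h7 := aux_one_le hF hF1 h5.1 h5.2
      have h8 := hA u
      rw [div_lt_iff₀ h8] at h3
      rw [div_lt_iff₀ (by linarith)]
      have h9 : 1 / ε * a ⌊u⁻¹⌋₊ < genInv F (1 - u) := by linarith
      have h10 := mul_lt_mul_of_pos_left h9 hε
      rw [← mul_assoc, mul_one_div_cancel hε.ne', one_mul] at h10
      exact h10
  refine aux_fin hF hF1 (fun u => a ⌊u⁻¹⌋₊ / genInv F (1 - u)) (fun s => -Real.log s) 0 le_rfl ?_
    (fun s hs => aux_small hF hF1 _ hA _ s hs hα (hd s hs)) ?_ ?_ ?_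
  · filter_upwards [aux_ev one_pos] with u h2
    rw [one_mul] at h2
    have := aux_one_le hF hF1 h2.1 h2.2
    have := hA u
    positivity
  · intro s hs hs1
    have := Real.log_neg hs hs1
    linarith
  · intro l hl
    rw [Real.log_div hl.ne' (by norm_num), Real.rpow_zero, Real.log_div one_ne_zero (by norm_num),
      Real.log_one]
    ring
  · simpa using aux_log_int (-1)

lemma aux_weibull {F : ℝ → ℝ} (hF : IsDF F) (hF1 : F 1 = 0) (γ : ℝ) (hγ : 0 < γ)
    (h : MemDomAttr F (weibullDF γ)) :
    RegVarAtZero (fun u => RpInf 1 (genInv (fun x => F (Real.exp x)) (1 - u))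
      (fun x => F (Real.exp x))) (1 / γ) := by
  obtain ⟨a, b, ha, hab⟩ := h
  have hA : ∀ u : ℝ, 0 < a ⌊u⁻¹⌋₊ := fun u => ha _
  have hγ' : 0 < 1 / γ := by positivity
  have hinv : ∀ s, 0 < s → Tendsto (fun u => (genInv F (1 - s * u) - b ⌊u⁻¹⌋₊) / a ⌊u⁻¹⌋₊)
      (𝓝[>] 0) (𝓝 (-(s ^ (1 / γ)))) := by
    intro s hs
    refine aux_inv hF hF1 (fun u => a ⌊u⁻¹⌋₊) (fun u => b ⌊u⁻¹⌋₊) hA (Iio 0) isOpen_Iio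
      (fun x => (-x) ^ γ) (fun x hx y hy hxy => ?_)
      (fun x hx => ?_) s _ hs ?_ ?_
    · have hy : y < 0 := hy
      exact Real.rpow_lt_rpow (by linarith) (by linarith) hγ
    · have hx : x < 0 := hx
      have hM : 0 < weibullDF γ x := by rw [weibullDF, if_pos hx]; exact Real.exp_pos _
      have hc : ContinuousAt (weibullDF γ) x := by
        have h1 : ContinuousAt (fun x : ℝ => Real.exp (-((-x) ^ γ))) x :=
          ((continuousAt_id.neg.rpow_const (Or.inr hγ.le)).neg).rexp
        refine h1.congr ?_
        filter_upwards [Iio_mem_nhds hx] with y hy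
        rw [weibullDF, if_pos (show y < 0 from hy)]
      have h1 := aux_tail_u hF a b x hM (hab x hc)
      rw [weibullDF, if_pos hx, Real.log_exp, neg_neg] at h1
      exact h1
    · have := Real.rpow_pos_of_pos hs (1 / γ)
      exact neg_lt_zero.2 this
    · simp only [neg_neg]
      rw [← Real.rpow_mul hs.le, one_div_mul_cancel hγ.ne', Real.rpow_one]
  have hd := aux_diff (F := F) _ _ _ hinv
  have hθ0 : (0:ℝ) ≤ (1 / 2) ^ (1 / γ) := by positivity
  have hθ1 : ((1:ℝ) / 2) ^ (1 / γ) < 1 := Real.rpow_lt_one (by norm_num) (by norm_num) hγ'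
  have hq1 : ((1:ℝ) / 4) ^ (1 / γ) < 1 := Real.rpow_lt_one (by norm_num) (by norm_num) hγ'
  simp only [Real.one_rpow] at hd
  have hrat := aux_ratio (fun u => genInv F (1 - u)) (fun u => a ⌊u⁻¹⌋₊) _
    (Eventually.of_forall hA) hd (by linarith) (1 / 2) (by norm_num) ((1 / 2) ^ (1 / γ)) (by
      rw [Real.div_rpow (x := 1 / 2) (y := 4) (by norm_num) (by norm_num),
        Real.div_rpow (x := 1) (y := 4) (by norm_num) (by norm_num), Real.one_rpow]
      ring)
  have ha0 : Tendsto (fun u : ℝ => a ⌊u⁻¹⌋₊) (𝓝[>] 0) (𝓝 0) := by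
    obtain ⟨θ, h1, h2⟩ := exists_between hθ1
    refine aux_contr _ (fun u => (hA u).le) θ (hθ0.trans h1.le) h2 (fun ε hε => ?_) (fun m hm => ?_)
    · filter_upwards [hrat.eventually (gt_mem_nhds h1)] with u hu
      rw [div_lt_iff₀ (hA u)] at hu
      linarith
    · obtain ⟨B, hB⟩ := aux_bdd a (fun n => (ha n).le) m hm
      exact ⟨B, fun u hu _ => hB u hu⟩
  have hα : Tendsto (fun u => a ⌊u⁻¹⌋₊ / genInv F (1 - u)) (𝓝[>] 0) (𝓝 0) := by
    refine squeeze_zero' ?_ ?_ ha0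
    · filter_upwards [aux_ev one_pos] with u h2
      rw [one_mul] at h2
      have := aux_one_le hF hF1 h2.1 h2.2
      have := hA u
      positivity
    · filter_upwards [aux_ev one_pos] with u h2
      rw [one_mul] at h2
      have := aux_one_le hF hF1 h2.1 h2.2
      exact div_le_self (hA u).le this
  refine aux_fin hF hF1 (fun u => a ⌊u⁻¹⌋₊ / genInv F (1 - u)) _ (1 / γ) hγ'.le ?_
    (fun s hs => aux_small hF hF1 _ hA _ s hs hα (hd s hs)) ?_ ?_ ?_
  · filter_upwards [aux_ev one_pos] with u h2
    rw [one_mul] at h2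
    have := aux_one_le hF hF1 h2.1 h2.2
    have := hA u
    positivity
  · intro s hs hs1
    have := Real.rpow_lt_one hs.le hs1 hγ'
    linarith
  · intro l hl
    rw [Real.div_rpow (x := l) (y := 4) (by linarith) (by norm_num),
        Real.div_rpow (x := 1) (y := 4) (by norm_num) (by norm_num), Real.one_rpow]
    ring
  · have h2 := intervalIntegral.intervalIntegrable_rpow' (a := 0) (b := 1)
        (show (-1:ℝ) < 1 / γ by linarith)
    rw [intervalIntegrable_iff_integrableOn_Ioc_of_le zero_le_one] at h2
    exact h2.neg.sub (integrableOn_const (by simp))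

lemma aux_frechet {F : ℝ → ℝ} (hF : IsDF F) (hF1 : F 1 = 0) (γ : ℝ) (hγ : 0 < γ)
    (h : MemDomAttr F (frechetDF γ)) :
    RegVarAtZero (fun u => RpInf 1 (genInv (fun x => F (Real.exp x)) (1 - u))
      (fun x => F (Real.exp x))) 0 := by
  obtain ⟨a, b, ha, hab⟩ := h
  have hA : ∀ u : ℝ, 0 < a ⌊u⁻¹⌋₊ := fun u => ha _
  have hγ' : 0 < 1 / γ := by positivity
  have hγn : -(1 / γ) < 0 := by linarith
  have hinv : ∀ s, 0 < s → Tendsto (fun u => (genInv F (1 - s * u) - b ⌊u⁻¹⌋₊) / a ⌊u⁻¹⌋₊)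
      (𝓝[>] 0) (𝓝 (s ^ (-(1 / γ)))) := by
    intro s hs
    refine aux_inv hF hF1 (fun u => a ⌊u⁻¹⌋₊) (fun u => b ⌊u⁻¹⌋₊) hA (Ioi 0) isOpen_Ioi
      (fun x => x ^ (-γ)) (fun x hx y hy hxy => ?_)
      (fun x hx => ?_) s _ hs ?_ ?_
    · exact Real.rpow_lt_rpow_of_neg hx hxy (by linarith)
    · have hx : 0 < x := hx
      have hM : 0 < frechetDF γ x := by rw [frechetDF, if_pos hx]; exact Real.exp_pos _
      have hc : ContinuousAt (frechetDF γ) x := by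
        have h1 : ContinuousAt (fun x : ℝ => Real.exp (-(x ^ (-γ)))) x :=
          ((continuousAt_id.rpow_const (Or.inl hx.ne')).neg).rexp
        refine h1.congr ?_
        filter_upwards [Ioi_mem_nhds hx] with y hy
        rw [frechetDF, if_pos (show 0 < y from hy)]
      have h1 := aux_tail_u hF a b x hM (hab x hc)
      rw [frechetDF, if_pos hx, Real.log_exp, neg_neg] at h1
      exact h1
    · exact Real.rpow_pos_of_pos hs _
    · rw [← Real.rpow_mul hs.le, neg_mul_neg, one_div_mul_cancel hγ.ne', Real.rpow_one]
  have hd := aux_diff (F := F) _ _ _ hinv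
  have hc1 : 1 < ((1:ℝ) / 2) ^ (-(1 / γ)) :=
    Real.one_lt_rpow_of_pos_of_lt_one_of_neg (by norm_num) (by norm_num) hγn
  have hq1 : 1 < ((1:ℝ) / 4) ^ (-(1 / γ)) :=
    Real.one_lt_rpow_of_pos_of_lt_one_of_neg (by norm_num) (by norm_num) hγn
  simp only [Real.one_rpow] at hd
  have hrat := aux_ratio (fun u => genInv F (1 - u)) (fun u => a ⌊u⁻¹⌋₊) _
    (Eventually.of_forall hA) hd (by linarith) (1 / 2) (by norm_num) ((1 / 2) ^ (-(1 / γ))) (by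
      rw [Real.div_rpow (x := 1 / 2) (y := 4) (by norm_num) (by norm_num),
        Real.div_rpow (x := 1) (y := 4) (by norm_num) (by norm_num), Real.one_rpow]
      ring)
  have hd2 := hd (1 / 2) (by norm_num)
  set c := ((1:ℝ) / 2) ^ (-(1 / γ)) with hc
  have hη : Tendsto (fun u => 1 + (genInv F (1 - 1 / 2 * u) - genInv F (1 - u)) / a ⌊u⁻¹⌋₊
      - a ⌊(1 / 2 * u)⁻¹⌋₊ / a ⌊u⁻¹⌋₊) (𝓝[>] 0) (𝓝 0) := by
    have := (hd2.const_add 1).sub hrat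
    simpa using this
  have hβ0 : Tendsto (fun u => |genInv F (1 - u) / a ⌊u⁻¹⌋₊ - 1|) (𝓝[>] 0) (𝓝 0) := by
    obtain ⟨κ, hκ1, hκ2⟩ := exists_between hc1
    refine aux_contr _ (fun u => abs_nonneg _) κ⁻¹ (by positivity) (inv_lt_one_of_one_lt₀ hκ1)
      (fun ε hε => ?_) (fun m hm => ?_)
    · filter_upwards [hrat.eventually (lt_mem_nhds hκ2),
        hη.eventually (Metric.ball_mem_nhds 0 hε)] with u h1 h2
      rw [dist_zero_right, Real.norm_eq_abs] at h2
      set η := 1 + (genInv F (1 - 1 / 2 * u) - genInv F (1 - u)) / a ⌊u⁻¹⌋₊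
        - a ⌊(1 / 2 * u)⁻¹⌋₊ / a ⌊u⁻¹⌋₊ with hηd
      set ρ := a ⌊(1 / 2 * u)⁻¹⌋₊ / a ⌊u⁻¹⌋₊ with hρ
      have h3 : ρ * (genInv F (1 - 1 / 2 * u) / a ⌊(1 / 2 * u)⁻¹⌋₊ - 1)
          = (genInv F (1 - u) / a ⌊u⁻¹⌋₊ - 1) + η := by
        have e1 := hA u
        have e2 := hA (1 / 2 * u)
        rw [hηd, hρ]
        generalize a ⌊u⁻¹⌋₊ = x at *
        generalize a ⌊(1 / 2 * u)⁻¹⌋₊ = y at *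
        field_simp
        ring
      have h4 : ρ * |genInv F (1 - 1 / 2 * u) / a ⌊(1 / 2 * u)⁻¹⌋₊ - 1|
          ≤ |genInv F (1 - u) / a ⌊u⁻¹⌋₊ - 1| + ε := by
        rw [← abs_of_pos (show 0 < ρ by linarith), ← abs_mul, h3]
        exact (abs_add_le _ _).trans (by linarith)
      have hκ0 : 0 < κ := by linarith
      generalize |genInv F (1 - 1 / 2 * u) / a ⌊(1 / 2 * u)⁻¹⌋₊ - 1| = X,
        hX : |genInv F (1 - 1 / 2 * u) / a ⌊(1 / 2 * u)⁻¹⌋₊ - 1| = X at *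
      have hX0 : 0 ≤ X := by rw [← hX]; exact abs_nonneg _
      generalize |genInv F (1 - u) / a ⌊u⁻¹⌋₊ - 1| = Y at *
      have h5 : κ * X ≤ Y + ε := le_trans (by gcongr) h4
      have h6 : X ≤ κ⁻¹ * (Y + ε) := by
        rw [inv_mul_eq_div, le_div_iff₀ hκ0]; linarith
      have h7 : κ⁻¹ * ε ≤ ε := by
        have := (inv_lt_one_of_one_lt₀ hκ1).le
        nlinarith
      linarith
    · obtain ⟨B, hB⟩ := aux_bdd (fun n => (a n)⁻¹) (fun n => (inv_pos.2 (ha n)).le) m hm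
      refine ⟨genInv F (1 - m) * B + 1, fun u hu hu2 => ?_⟩
      have hanti := aux_anti (G := F) (W := fun u => genInv F (1 - u))
        (fun u hu hu1 t => aux_gal hF hF1 hu hu1 t)
      have h1 : genInv F (1 - u) ≤ genInv F (1 - m) :=
        hanti ⟨hm, by linarith⟩ ⟨by linarith, by linarith⟩ hu
      have h2 := aux_one_le hF hF1 (show 0 < u by linarith) (by linarith)
      have h3 := hB u hu
      have h4 := inv_pos.2 (hA u)
      refine (abs_sub _ _).trans ?_
      rw [abs_one, abs_of_pos (div_pos (by linarith) (hA u)), div_eq_mul_inv]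
      gcongr
      linarith
  have hβ : Tendsto (fun u => genInv F (1 - u) / a ⌊u⁻¹⌋₊) (𝓝[>] 0) (𝓝 1) := by
    have := ((tendsto_zero_iff_abs_tendsto_zero _).2 hβ0).const_add 1
    simpa using this
  refine aux_fin hF hF1 (fun _ => 1) (fun s => -(1 / γ) * Real.log s) 0 le_rfl ?_
    (fun s hs => ?_) ?_ ?_ ?_
  · exact Eventually.of_forall fun _ => one_pos
  · have h1 := (hβ.add (hd s hs)).div hβ one_ne_zero
    rw [add_sub_cancel, div_one] at h1
    have hsp : 0 < s ^ (-(1 / γ)) := Real.rpow_pos_of_pos hs _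
    have h2 := (Real.continuousAt_log hsp.ne').tendsto.comp h1
    rw [Real.log_rpow hs] at h2
    refine h2.congr' ?_
    filter_upwards [aux_ev one_pos, aux_ev hs] with u h2 h3
    rw [one_mul] at h2
    have h4 := aux_one_le hF hF1 h2.1 h2.2
    have h5 := aux_one_le hF hF1 h3.1 h3.2
    have h6 := hA u
    rw [div_one, ← Real.log_div (by positivity) (by positivity)]
    change Real.log ((genInv F (1 - u) / a ⌊u⁻¹⌋₊ + (genInv F (1 - s * u) - genInv F (1 - u)) /
      a ⌊u⁻¹⌋₊) / (genInv F (1 - u) / a ⌊u⁻¹⌋₊)) = _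
    congr 1
    generalize a ⌊u⁻¹⌋₊ = x at *
    field_simp
    ring
  · intro s hs hs1
    have := Real.log_neg hs hs1
    nlinarith
  · intro l hl
    rw [Real.log_div hl.ne' (by norm_num), Real.rpow_zero, Real.log_div one_ne_zero (by norm_num),
      Real.log_one]
    ring
  · exact aux_log_int _

/-- Lemma 3.4. -/
theorem rOne_regular_variation (F : ℝ → ℝ) (hF : IsDF F) (hF1 : F 1 = 0)
    (G : ℝ → ℝ) (hG : G = fun x => F (Real.exp x))
    (r : ℝ → ℝ) (hr : r = fun u => RpInf 1 (genInv G (1 - u)) G) :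
    ((MemFrechetDom F ∨ MemDomAttr F gumbelDF) → RegVarAtZero r 0) ∧
    (∀ γ : ℝ, 0 < γ → MemDomAttr F (weibullDF γ) → RegVarAtZero r (1 / γ)) := by
  subst hG hr
  refine ⟨?_, fun γ hγ h => aux_weibull hF hF1 γ hγ h⟩
  rintro (⟨γ, hγ, h⟩ | h)
  · exact aux_frechet hF hF1 γ hγ h
  · exact aux_gumbel hF hF1 h

end
end

section
/- Lemma 4.1(i): let H be a distribution function with H ∈ D(ψ_γ) for some γ > 0 and finite upper endpoint x₀ = sup{x : H(x) < 1}. Then for every integer p ≥ 1, R_p(x, H) ~ (x₀ − x)^p ∏_{j=1}^{p} (γ + j)^{−1} as x → x₀−. -/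
open MeasureTheory Filter Topology Set

noncomputable section

lemma aux_log_s10 (y : ℕ → ℝ) (h0 : ∀ n, 0 ≤ y n) (c : ℝ)
    (h : Tendsto (fun n => y n ^ n) atTop (𝓝 (Real.exp (-c)))) :
    Tendsto (fun n : ℕ => (n : ℝ) * (1 - y n)) atTop (𝓝 c) := by
  have hlog : Tendsto (fun n : ℕ => (n : ℝ) * Real.log (y n)) atTop (𝓝 (-c)) := by
    have := (Real.continuousAt_log (Real.exp_pos (-c)).ne').tendsto.comp h
    rw [Real.log_exp] at this
    refine this.congr fun n => ?_
    simp [Real.log_pow]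
  have hpos : ∀ᶠ n in atTop, 0 < y n := by
    filter_upwards [h.eventually (lt_mem_nhds (Real.exp_pos (-c))), eventually_ge_atTop 1]
      with n hn h1
    rcases (h0 n).lt_or_eq with h2 | h2
    · exact h2
    · rw [← h2, zero_pow (by omega)] at hn
      exact absurd hn (lt_irrefl _)
  have hl0 : Tendsto (fun n : ℕ => Real.log (y n)) atTop (𝓝 0) := by
    have := hlog.mul (tendsto_inv_atTop_nhds_zero_nat (𝕜 := ℝ))
    rw [mul_zero] at this
    refine this.congr' ?_
    filter_upwards [eventually_ge_atTop 1] with n hn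
    have : (n : ℝ) ≠ 0 := by positivity
    field_simp
  have hy1 : Tendsto y atTop (𝓝 1) := by
    have := (Real.continuous_exp.tendsto 0).comp hl0
    rw [Real.exp_zero] at this
    refine this.congr' ?_
    filter_upwards [hpos] with n hn
    simp [Real.exp_log hn]
  have hup : Tendsto (fun n : ℕ => -((n : ℝ) * Real.log (y n))) atTop (𝓝 c) := by
    simpa using hlog.neg
  have hlow : Tendsto (fun n : ℕ => y n * -((n : ℝ) * Real.log (y n))) atTop (𝓝 c) := by
    simpa using hy1.mul hup
  refine tendsto_of_tendsto_of_tendsto_of_le_of_le' hlow hup ?_ ?_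
  · filter_upwards [hpos] with n hn
    have h1 := Real.log_le_sub_one_of_pos (inv_pos.2 hn)
    rw [Real.log_inv] at h1
    have h2 : y n * (-Real.log (y n)) ≤ 1 - y n := by
      calc y n * (-Real.log (y n)) ≤ y n * ((y n)⁻¹ - 1) := by gcongr
        _ = 1 - y n := by field_simp
    have h3 := mul_le_mul_of_nonneg_left h2 (Nat.cast_nonneg (α := ℝ) n)
    linarith
  · filter_upwards [hpos] with n hn
    have h1 := Real.log_le_sub_one_of_pos hn
    have h3 := mul_le_mul_of_nonneg_left h1 (Nat.cast_nonneg (α := ℝ) n)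
    linarith

lemma aux_squeeze {ι : Type*} {l : Filter ι} (f : ι → ℝ → ℝ) (hf : ∀ i, Monotone (f i))
    (γ : ℝ) (h : ∀ s, 0 < s → Tendsto (fun i => f i s) l (𝓝 (s ^ γ)))
    (t : ι → ℝ) (s : ℝ) (hs : 0 < s) (ht : Tendsto t l (𝓝 s)) :
    Tendsto (fun i => f i (t i)) l (𝓝 (s ^ γ)) := by
  have hc : ContinuousAt (fun x : ℝ => x ^ γ) s := Real.continuousAt_rpow_const s γ (Or.inl hs.ne')
  rw [tendsto_order]
  constructor
  · intro a ha
    have h1 : ∀ᶠ x in 𝓝[<] s, a < x ^ γ ∧ 0 < x ∧ x < s := by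
      filter_upwards [nhdsWithin_le_nhds (hc.eventually (lt_mem_nhds ha)),
        nhdsWithin_le_nhds (lt_mem_nhds hs), self_mem_nhdsWithin] with x h1 h2 h3
      exact ⟨h1, h2, h3⟩
    obtain ⟨x, h1, h2, h3⟩ := h1.exists
    filter_upwards [(h x h2).eventually (lt_mem_nhds h1), ht.eventually (lt_mem_nhds h3)]
      with i hi hi2
    exact hi.trans_le (hf i hi2.le)
  · intro a ha
    have h1 : ∀ᶠ x in 𝓝[>] s, x ^ γ < a ∧ 0 < x ∧ s < x := by
      filter_upwards [nhdsWithin_le_nhds (hc.eventually (gt_mem_nhds ha)),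
        nhdsWithin_le_nhds (lt_mem_nhds hs), self_mem_nhdsWithin] with x h1 h2 h3
      exact ⟨h1, h2, h3⟩
    obtain ⟨x, h1, h2, h3⟩ := h1.exists
    filter_upwards [(h x h2).eventually (gt_mem_nhds h1), ht.eventually (gt_mem_nhds h3)]
      with i hi hi2
    exact (hf i hi2.le).trans_lt hi

/-- regular variation from sequential convergence -/
lemma aux_rv (U : ℝ → ℝ) (hU : Monotone U) (hpos : ∀ u, 0 < u → 0 < U u) (γ : ℝ) (hγ : 0 < γ)
    (a : ℕ → ℝ) (ha : ∀ n, 0 < a n)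
    (h : ∀ s, 0 < s → Tendsto (fun n : ℕ => (n : ℝ) * U (a n * s)) atTop (𝓝 (s ^ γ))) :
    RegVarAtZero U γ := by
  -- U tends to 0
  have hU0 : Tendsto U (𝓝[>] 0) (𝓝[>] 0) := by
    refine tendsto_nhdsWithin_iff.2 ⟨?_, ?_⟩
    · rw [tendsto_order]
      constructor
      · intro c hc
        filter_upwards [self_mem_nhdsWithin] with u hu
        exact hc.trans (hpos u hu)
      · intro c hc
        have h1 := h 1 one_pos
        have h2 : ∀ᶠ n : ℕ in atTop, (n : ℝ) * U (a n * 1) < 2 :=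
          h1.eventually (gt_mem_nhds (by simp))
        have h3 : ∀ᶠ n : ℕ in atTop, 2 / c < (n : ℝ) :=
          tendsto_natCast_atTop_atTop.eventually (eventually_gt_atTop _)
        obtain ⟨n, hn, hn2⟩ := (h2.and h3).exists
        have hn3 : U (a n) < c := by
          by_contra hcon
          push Not at hcon
          rw [mul_one] at hn
          rw [div_lt_iff₀ hc] at hn2
          have := mul_le_mul_of_nonneg_left hcon (Nat.cast_nonneg (α := ℝ) n)
          linarith
        filter_upwards [nhdsWithin_le_nhds (gt_mem_nhds (ha n))] with u hu
        exact (hU hu.le).trans_lt hn3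
    · filter_upwards [self_mem_nhdsWithin] with u hu
      exact hpos u hu
  let N : ℝ → ℕ := fun u => ⌊(U u)⁻¹⌋₊
  have hinv : Tendsto (fun u => (U u)⁻¹) (𝓝[>] 0) atTop := tendsto_inv_nhdsGT_zero.comp hU0
  have hN : Tendsto N (𝓝[>] 0) atTop := tendsto_nat_floor_atTop.comp hinv
  have hNU : Tendsto (fun u => (N u : ℝ) * U u) (𝓝[>] 0) (𝓝 1) := by
    have := (tendsto_nat_floor_div_atTop (R := ℝ)).comp hinv
    refine this.congr fun u => ?_
    simp [N]
  have hfs : ∀ s, 0 < s → Tendsto (fun u => (N u : ℝ) * U (a (N u) * s)) (𝓝[>] 0) (𝓝 (s ^ γ)) :=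
    fun s hs => (h s hs).comp hN
  have hta : Tendsto (fun u => u / a (N u)) (𝓝[>] 0) (𝓝 1) := by
    rw [tendsto_order]
    constructor
    · intro c hc
      have hs : 0 < max c (1/2) := by positivity
      have hs1 : max c (1/2) < 1 := max_lt hc (by norm_num)
      have h1 : (max c (1/2)) ^ γ < 1 := Real.rpow_lt_one hs.le hs1 hγ
      filter_upwards [(hfs _ hs).eventually_lt hNU h1] with u hu
      have h2 : U (a (N u) * max c (1/2)) < U u := lt_of_mul_lt_mul_left hu (Nat.cast_nonneg _)
      have h3 := hU.reflect_lt h2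
      rw [lt_div_iff₀ (ha _)]
      refine lt_of_le_of_lt ?_ h3
      rw [mul_comm]
      exact mul_le_mul_of_nonneg_left (le_max_left _ _) (ha _).le
    · intro c hc
      have h1 : 1 < c ^ γ := Real.one_lt_rpow hc hγ
      filter_upwards [hNU.eventually_lt (hfs c (by linarith)) h1] with u hu
      have h2 : U u < U (a (N u) * c) := lt_of_mul_lt_mul_left hu (Nat.cast_nonneg _)
      have h3 := hU.reflect_lt h2
      rw [div_lt_iff₀ (ha _)]
      linarith
  intro l hl
  have ht : Tendsto (fun u => l * (u / a (N u))) (𝓝[>] 0) (𝓝 l) := by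
    simpa using hta.const_mul l
  have key := aux_squeeze (l := 𝓝[>] (0:ℝ)) (fun u s => (N u : ℝ) * U (a (N u) * s))
    (fun u s s' hss => mul_le_mul_of_nonneg_left
      (hU (mul_le_mul_of_nonneg_left hss (ha _).le)) (Nat.cast_nonneg _)) γ hfs _ l hl ht
  have := key.div hNU one_ne_zero
  rw [div_one] at this
  refine this.congr' ?_
  filter_upwards [hN.eventually (eventually_ge_atTop 1)] with u hu
  have h1 : (N u : ℝ) ≠ 0 := by positivity
  have h2 : a (N u) * (l * (u / a (N u))) = l * u := by
    have := (ha (N u)).ne'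
    field_simp
  simp only [Pi.div_apply, h2]
  rw [mul_div_mul_left _ _ h1]

/-- Karamata step -/
lemma aux_kar (G : ℝ → ℝ) (hG : MonotoneOn G (Ici 0)) (hG0 : 0 ≤ G 0) (hpos : ∀ u, 0 < u → 0 < G u)
    (d : ℝ) (hd : 0 < d) (hrv : RegVarAtZero G d) (K : ℝ → ℝ)
    (hK : ∀ u, K u = ∫ v in (0:ℝ)..u, G v) :
    MonotoneOn K (Ici 0) ∧ 0 ≤ K 0 ∧ (∀ u, 0 < u → 0 < K u) ∧ RegVarAtZero K (d + 1) ∧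
      Tendsto (fun u => K u / (u * G u)) (𝓝[>] 0) (𝓝 (d + 1)⁻¹) := by
  have hint : ∀ u w, 0 ≤ u → 0 ≤ w → IntervalIntegrable G volume u w := by
    intro u w hu hw
    refine MonotoneOn.intervalIntegrable (hG.mono ?_)
    intro x hx
    exact (le_min hu hw).trans hx.1
  have hnn : ∀ u, 0 ≤ u → 0 ≤ G u := fun u hu => hG0.trans (hG (mem_Ici.2 le_rfl) hu hu)
  have hpK : ∀ u, 0 < u → 0 < K u := by
    intro u hu
    rw [hK]
    exact intervalIntegral.intervalIntegral_pos_of_pos_on (hint 0 u le_rfl hu.le)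
      (fun x hx => hpos x hx.1) hu
  have hlim : Tendsto (fun u => K u / (u * G u)) (𝓝[>] 0) (𝓝 (d + 1)⁻¹) := by
    have h1 : Tendsto (fun u => ∫ l in (0:ℝ)..1, G (l * u) / G u) (𝓝[>] 0)
        (𝓝 (∫ l in (0:ℝ)..1, l ^ d)) := by
      refine intervalIntegral.tendsto_integral_filter_of_dominated_convergence (fun _ => (1:ℝ))
        ?_ ?_ ?_ ?_
      · filter_upwards [self_mem_nhdsWithin] with u hu
        have hu : 0 < u := hu
        have hm : MonotoneOn (fun l => G (l * u) / G u) (uIcc 0 1) := by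
          intro x hx y hy hxy
          rw [uIcc_of_le zero_le_one] at hx hy
          exact div_le_div_of_nonneg_right (hG (mul_nonneg hx.1 hu.le) (mul_nonneg hy.1 hu.le)
            (mul_le_mul_of_nonneg_right hxy hu.le)) (hpos u hu).le
        have := (MonotoneOn.intervalIntegrable (μ := volume) hm).def'
        exact this.aestronglyMeasurable
      · filter_upwards [self_mem_nhdsWithin] with u hu
        have hu : 0 < u := hu
        refine Eventually.of_forall fun x hx => ?_
        rw [uIoc_of_le zero_le_one] at hx
        have h0 : 0 ≤ x * u := mul_nonneg hx.1.le hu.le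
        rw [Real.norm_of_nonneg (div_nonneg (hnn _ h0) (hpos u hu).le), div_le_one (hpos u hu)]
        exact hG h0 hu.le (by nlinarith [hx.2])
      · exact intervalIntegrable_const
      · refine Eventually.of_forall fun x hx => ?_
        rw [uIoc_of_le zero_le_one] at hx
        exact hrv x hx.1
    have h2 : ∫ l in (0:ℝ)..1, l ^ d = (d + 1)⁻¹ := by
      rw [integral_rpow (Or.inl (by linarith))]
      rw [Real.one_rpow, Real.zero_rpow (by linarith)]
      simp
    rw [h2] at h1
    refine h1.congr' ?_
    filter_upwards [self_mem_nhdsWithin] with u hu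
    have hu : 0 < u := hu
    rw [intervalIntegral.integral_div, intervalIntegral.integral_comp_mul_right _ hu.ne', hK]
    have := (hpos u hu).ne'
    simp only [zero_mul, one_mul, smul_eq_mul]
    field_simp
  refine ⟨?_, ?_, hpK, ?_, hlim⟩
  · intro x hx y hy hxy
    have hx : 0 ≤ x := hx
    rw [hK, hK, ← sub_nonneg, intervalIntegral.integral_interval_sub_left (hint 0 y le_rfl hy)
      (hint 0 x le_rfl hx)]
    exact intervalIntegral.integral_nonneg hxy fun z hz => hnn z (hx.trans hz.1)
  · rw [hK]; simp
  · intro l hl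
    have hs : Tendsto (fun u : ℝ => l * u) (𝓝[>] 0) (𝓝[>] 0) := by
      refine tendsto_nhdsWithin_iff.2 ⟨?_, ?_⟩
      · have : Tendsto (fun u : ℝ => l * u) (𝓝 0) (𝓝 (l * 0)) := (continuous_const_mul l).tendsto 0
        rw [mul_zero] at this
        exact this.mono_left nhdsWithin_le_nhds
      · filter_upwards [self_mem_nhdsWithin] with u hu
        exact mul_pos hl hu
    have hd1 : (d + 1)⁻¹ ≠ 0 := by positivity
    have := (((hlim.comp hs).div hlim hd1).mul (hrv l hl)).mul_const l
    rw [div_self hd1, one_mul, ← Real.rpow_add_one hl.ne'] at this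
    refine this.congr' ?_
    filter_upwards [self_mem_nhdsWithin] with u hu
    have hu : 0 < u := hu
    have e1 := (hpos u hu).ne'
    have e2 := (hpos (l * u) (mul_pos hl hu)).ne'
    have e3 := (hpK u hu).ne'
    simp only [Pi.div_apply, Function.comp]
    field_simp

lemma aux_weib (γ : ℝ) (hγ : 0 < γ) (x : ℝ) :
    weibullDF γ x = Real.exp (-((max (-x) 0) ^ γ)) := by
  unfold weibullDF
  split_ifs with h
  · rw [max_eq_left (by linarith)]
  · rw [max_eq_right (by linarith), Real.zero_rpow hγ.ne']
    simp

lemma aux_main_s10 (H : ℝ → ℝ) (hH : IsDF H) (γ : ℝ) (hγ : 0 < γ)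
    (hdom : MemDomAttr H (weibullDF γ)) (z : ℝ) (hlt : ∀ x, x < z → H x < 1)
    (hge : ∀ x, z ≤ x → H x = 1) :
    RegVarAtZero (fun u => 1 - H (z - u)) γ := by
  obtain ⟨hmono, -, hbot, htop⟩ := hH
  have h0 : ∀ x, 0 ≤ H x := fun x => hmono.le_of_tendsto hbot x
  obtain ⟨a, b, ha, hab⟩ := hdom
  have hcont : Continuous (weibullDF γ) := by
    have : weibullDF γ = fun x => Real.exp (-((max (-x) 0) ^ γ)) := funext (aux_weib γ hγ)
    rw [this]
    have h1 : Continuous fun x : ℝ => (max (-x) 0) ^ γ :=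
      (continuous_neg.max continuous_const).rpow_const fun x => Or.inr hγ.le
    fun_prop
  have hV : ∀ x, Tendsto (fun n : ℕ => (n : ℝ) * (1 - H (a n * x + b n))) atTop
      (𝓝 ((max (-x) 0) ^ γ)) := by
    intro x
    apply aux_log_s10 _ (fun n => h0 _)
    rw [← aux_weib γ hγ]
    exact hab x hcont.continuousAt
  have h2n : Tendsto (fun n : ℕ => 2 * n) atTop atTop := by
    apply tendsto_atTop_mono (f := fun n => n) (fun n => by omega) tendsto_id
  have hV2 : ∀ x, Tendsto (fun n : ℕ => 2 * (n : ℝ) * (1 - H (a (2*n) * x + b (2*n)))) atTop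
      (𝓝 ((max (-x) 0) ^ γ)) := by
    intro x
    refine ((hV x).comp h2n).congr fun n => ?_
    simp [Function.comp]
  have hV1 : ∀ x, Tendsto (fun n : ℕ => 2 * (n : ℝ) * (1 - H (a n * x + b n))) atTop
      (𝓝 (2 * (max (-x) 0) ^ γ)) := by
    intro x
    refine ((hV x).const_mul 2).congr fun n => ?_
    ring
  have hB : ∀ x y : ℝ, (max (-x) 0) ^ γ < 2 * (max (-y) 0) ^ γ →
      ∀ᶠ n in atTop, a n * y + b n < a (2*n) * x + b (2*n) := by
    intro x y hxy
    filter_upwards [(hV2 x).eventually_lt (hV1 y) hxy] with n hn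
    have := lt_of_mul_lt_mul_left hn (by positivity)
    exact hmono.reflect_lt (by linarith)
  have hA : ∀ x y : ℝ, 2 * (max (-y) 0) ^ γ < (max (-x) 0) ^ γ →
      ∀ᶠ n in atTop, a (2*n) * x + b (2*n) < a n * y + b n := by
    intro x y hxy
    filter_upwards [(hV1 y).eventually_lt (hV2 x) hxy] with n hn
    have := lt_of_mul_lt_mul_left hn (by positivity)
    exact hmono.reflect_lt (by linarith)
  -- lower bound
  have hlow : ∀ ε : ℝ, 0 < ε → ∀ᶠ n in atTop, a n * (-ε) + b n < z := by
    intro ε hε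
    have : (0:ℝ) < (max (- -ε) 0) ^ γ := by
      rw [neg_neg, max_eq_left hε.le]; positivity
    filter_upwards [(hV (-ε)).eventually (lt_mem_nhds this)] with n hn
    by_contra hc
    push Not at hc
    rw [hge _ hc] at hn
    simp at hn
  have hupp : ∀ ε : ℝ, 0 < ε → ∀ᶠ n in atTop, z ≤ a n * ε + b n := by
    intro ε hε
    set q : ℝ := (3/4 : ℝ) ^ (γ⁻¹) with hq
    have hq0 : 0 < q := by positivity
    have hq1 : q < 1 := Real.rpow_lt_one (by norm_num) (by norm_num) (by positivity)
    have hqγ : q ^ γ = 3/4 := by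
      rw [hq, ← Real.rpow_mul (by norm_num), inv_mul_cancel₀ hγ.ne', Real.rpow_one]
    set δ : ℝ := ε * (1 - q) / (q + ε) with hδ
    have hδ0 : 0 < δ := by
      have : 0 < 1 - q := by linarith
      positivity
    have hδe : δ * (q + ε) = ε * (1 - q) := by
      rw [hδ]; field_simp
    have e1 := hB (-1) (-q) (by
      rw [neg_neg, neg_neg, max_eq_left zero_le_one, max_eq_left hq0.le, hqγ, Real.one_rpow]
      norm_num)
    have e2 := hA (-δ) 0 (by
      rw [neg_neg, neg_zero, max_self, max_eq_left hδ0.le, Real.zero_rpow hγ.ne']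
      rw [mul_zero]; positivity)
    have hstep : ∀ᶠ n in atTop, a (2*n) * ε + b (2*n) ≤ a n * ε + b n := by
      filter_upwards [e1, e2] with n h1 h2
      have p1 := ha n
      have p2 := ha (2*n)
      -- (1-δ) a2 < q a, b2 - b < δ a2
      have h3 : (1 - δ) * a (2*n) < q * a n := by linarith
      have h4 : (δ + ε) * a (2*n) * q ≤ ε * a n * q := by
        have : (δ + ε) * q = ε * (1 - δ) := by linarith
        calc (δ + ε) * a (2*n) * q = ((δ + ε) * q) * a (2*n) := by ring
          _ = ε * ((1 - δ) * a (2*n)) := by rw [this]; ring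
          _ ≤ ε * (q * a n) := by gcongr
          _ = _ := by ring
      have h5 := le_of_mul_le_mul_right h4 hq0
      linarith
    obtain ⟨N, hN⟩ := eventually_atTop.1 hstep
    filter_upwards [eventually_ge_atTop (max N 1)] with n hn
    have hnN : N ≤ n := (le_max_left _ _).trans hn
    have hn1 : 1 ≤ n := (le_max_right _ _).trans hn
    have hit : ∀ k : ℕ, a (2^k * n) * ε + b (2^k * n) ≤ a n * ε + b n := by
      intro k
      induction k with
      | zero => simp
      | succ k ih =>
        have : 2^(k+1) * n = 2 * (2^k * n) := by ring
        rw [this]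
        refine (hN _ ?_).trans ih
        exact hnN.trans (Nat.le_mul_of_pos_left _ (by positivity))
    refine le_of_forall_lt fun y hy => ?_
    have hV0 : Tendsto (fun n : ℕ => (n : ℝ) * (1 - H (a n * ε + b n))) atTop (𝓝 0) := by
      have := hV ε
      rwa [max_eq_right (by linarith), Real.zero_rpow hγ.ne'] at this
    have hev : ∀ᶠ m in atTop, y < a m * ε + b m := by
      have hy1 : 0 < 1 - H y := by linarith [hlt y hy]
      filter_upwards [hV0.eventually (gt_mem_nhds hy1), eventually_ge_atTop 1] with m hm hm1
      by_contra hc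
      push Not at hc
      have h1 := hmono hc
      have h2 : (1:ℝ) ≤ m := by exact_mod_cast hm1
      nlinarith
    have hk : Tendsto (fun k : ℕ => 2^k * n) atTop atTop := by
      apply tendsto_atTop_mono (f := fun n => n) (fun k => ?_) tendsto_id
      calc k ≤ 2^k := Nat.lt_two_pow_self.le
        _ ≤ 2^k * n := Nat.le_mul_of_pos_right _ hn1
    obtain ⟨k, hk⟩ := (hk.eventually hev).exists
    exact hk.trans_le (hit k)
  have hratio : Tendsto (fun n => (z - b n) / a n) atTop (𝓝 0) := by
    rw [tendsto_order]
    constructor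
    · intro c hc
      filter_upwards [hlow (-c) (by linarith)] with n hn
      rw [lt_div_iff₀ (ha n)]
      linarith
    · intro c hc
      filter_upwards [hupp (c/2) (by linarith)] with n hn
      rw [div_lt_iff₀ (ha n)]
      nlinarith [ha n]
  refine aux_rv _ (fun x y hxy => ?_) (fun u hu => ?_) γ hγ a ha ?_
  · have := hmono (show z - y ≤ z - x by linarith)
    linarith
  · have := hlt (z - u) (by linarith)
    linarith
  · intro s hs
    have ht : Tendsto (fun n => s - (z - b n) / a n) atTop (𝓝 s) := by
      simpa using hratio.const_sub s
    have := aux_squeeze (fun (n : ℕ) s => (n : ℝ) * (1 - H (a n * (-s) + b n))) ?_ γ ?_ _ s hs ht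
    · refine this.congr fun n => ?_
      have := (ha n).ne'
      have e : a n * (-(s - (z - b n) / a n)) + b n = z - a n * s := by
        field_simp; ring
      simp only [e]
    · intro n x y hxy
      have := hmono (show a n * (-y) + b n ≤ a n * (-x) + b n by nlinarith [ha n])
      exact mul_le_mul_of_nonneg_left (by linarith) (Nat.cast_nonneg _)
    · intro s hs
      have := hV (-s)
      rwa [neg_neg, max_eq_left hs.le] at this

lemma aux_ind (H : ℝ → ℝ) (hmono : Monotone H) (γ : ℝ) (hγ : 0 < γ) (z : ℝ)
    (hlt : ∀ x, x < z → H x < 1) (hge : ∀ x, z ≤ x → H x = 1)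
    (hrv : RegVarAtZero (fun u => 1 - H (z - u)) γ) (p : ℕ) :
    let J : ℝ → ℝ := fun u => iterInt H z p (z - u)
    MonotoneOn J (Ici 0) ∧ 0 ≤ J 0 ∧ (∀ u, 0 < u → 0 < J u) ∧
      RegVarAtZero J (γ + (p + 1 : ℕ)) ∧
      Tendsto (fun u => J u / (u ^ (p + 1) * (1 - H (z - u)))) (𝓝[>] 0)
        (𝓝 (∏ j ∈ Finset.Icc 1 (p + 1), (γ + (j : ℝ))⁻¹)) := by
  induction p with
  | zero =>
    intro J
    have := aux_kar (fun u => 1 - H (z - u)) (fun x _ y _ hxy => by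
        have := hmono (show z - y ≤ z - x by linarith)
        simp only
        linarith) (by simp [hge z le_rfl]) (fun u hu => by
          have := hlt (z - u) (by linarith)
          linarith) γ hγ hrv J (fun u => by
            simp only [J, iterInt]
            rw [intervalIntegral.integral_comp_sub_left (fun t => 1 - H t) z]
            simp)
    simpa using this
  | succ p ih =>
    intro J
    obtain ⟨i1, i2, i3, i4, i5⟩ := ih
    obtain ⟨k1, k2, k3, k4, k5⟩ := aux_kar _ i1 i2 i3 _ (by positivity) i4 J (fun u => by
            simp only [J, iterInt]
            rw [intervalIntegral.integral_comp_sub_left (fun t => iterInt H z p t) z]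
            simp)
    refine ⟨k1, k2, k3, ?_, ?_⟩
    · convert k4 using 1
      push_cast; ring
    · have := i5.mul k5
      rw [Finset.prod_Icc_succ_top (by omega)]
      have e : ((γ + ((p + 1 + 1 : ℕ) : ℝ))⁻¹) = (γ + ((p + 1 : ℕ) : ℝ) + 1)⁻¹ := by
        push_cast; ring
      rw [e]
      refine this.congr' ?_
      filter_upwards [self_mem_nhdsWithin] with u hu
      have hu : 0 < u := hu
      have e1 := (i3 u hu).ne'
      have e2 : (1 - H (z - u)) ≠ 0 := by
        have := hlt (z - u) (by linarith)
        linarith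
      field_simp
      ring

/-- Lemma 4.1(i). -/
theorem Rp_asymp_weibull (H : ℝ → ℝ) (hH : IsDF H) (γ : ℝ) (hγ : 0 < γ)
    (hdom : MemDomAttr H (weibullDF γ)) (hbdd : BddAbove {x | H x < 1})
    (p : ℕ) (hp : 1 ≤ p) :
    Tendsto (fun x => Rp p x (upEnd H) H /
        ((upEnd H - x) ^ p * ∏ j ∈ Finset.Icc 1 p, (γ + (j : ℝ))⁻¹))
      (𝓝[<] upEnd H) (𝓝 1) := by
  have hmono := hH.1
  have hle1 : ∀ x, H x ≤ 1 := fun x => hmono.ge_of_tendsto hH.2.2.2 x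
  have hne : {x | H x < 1}.Nonempty := (hH.2.2.1.eventually (gt_mem_nhds one_pos)).exists
  have hlt : ∀ x, x < upEnd H → H x < 1 := by
    intro x hx
    obtain ⟨y, hy, hxy⟩ := exists_lt_of_lt_csSup hne hx
    exact (hmono hxy.le).trans_lt hy
  have hgt : ∀ x, upEnd H < x → H x = 1 := by
    intro x hx
    refine le_antisymm (hle1 x) ?_
    by_contra hc
    push Not at hc
    exact absurd (le_csSup hbdd hc) (not_le.2 hx)
  have hz : H (upEnd H) = 1 := by
    have h1 : Tendsto H (𝓝[>] upEnd H) (𝓝 (H (upEnd H))) :=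
      (hH.2.1 (upEnd H)).mono_left (nhdsWithin_mono _ Ioi_subset_Ici_self)
    have h2 : Tendsto H (𝓝[>] upEnd H) (𝓝 1) := by
      refine tendsto_const_nhds.congr' ?_
      filter_upwards [self_mem_nhdsWithin] with x hx
      exact (hgt x hx).symm
    exact tendsto_nhds_unique h1 h2
  have hge : ∀ x, upEnd H ≤ x → H x = 1 := by
    intro x hx
    rcases hx.eq_or_lt with h | h
    · rw [← h, hz]
    · exact hgt x h
  obtain ⟨q, rfl⟩ : ∃ q, p = q + 1 := ⟨p - 1, by omega⟩
  have hrv := aux_main_s10 H hH γ hγ hdom _ hlt hge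
  obtain ⟨-, -, -, -, h5⟩ := aux_ind H hmono γ hγ _ hlt hge hrv q
  set P := ∏ j ∈ Finset.Icc 1 (q + 1), (γ + (j : ℝ))⁻¹ with hP
  have hP0 : P ≠ 0 := by
    have : 0 < P := Finset.prod_pos fun j _ => by positivity
    exact this.ne'
  have hs : Tendsto (fun x => upEnd H - x) (𝓝[<] upEnd H) (𝓝[>] 0) := by
    refine tendsto_nhdsWithin_iff.2 ⟨?_, ?_⟩
    · have : Tendsto (fun x => upEnd H - x) (𝓝 (upEnd H)) (𝓝 (upEnd H - upEnd H)) :=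
        (continuous_const.sub continuous_id).tendsto _
      rw [sub_self] at this
      exact this.mono_left nhdsWithin_le_nhds
    · filter_upwards [self_mem_nhdsWithin] with x hx
      have hx : x < upEnd H := hx
      exact sub_pos.2 hx
  have := (h5.comp hs).div_const P
  rw [div_self hP0] at this
  refine this.congr fun x => ?_
  simp only [Function.comp, Rp, sub_sub_cancel, Nat.add_sub_cancel]
  simp only [div_eq_mul_inv, mul_inv]
  ring

end
end

section
/- Lemma 4.1(ii): let F be a distribution function with F(1) = 0 and F ∈ D(Λ) ∪ D(φ), and let G(x) = F(e^x) with upper endpoint y₀ = sup{x : G(x) < 1}. Then for every integer p ≥ 1, R_p(x, G) ~ R_1(x, G)^p as x → y₀−. -/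
open MeasureTheory Filter Topology Set

noncomputable section

/-- Approach to the upper endpoint of a survival function. -/
def LF (W : ℝ → ℝ) : Filter ℝ := comap W (𝓝[>] 0)

instance LF_cg (W : ℝ → ℝ) : (LF W).IsCountablyGenerated := by
  unfold LF; infer_instance

lemma ev_LF {W : ℝ → ℝ} {P : ℝ → Prop} :
    (∀ᶠ x in LF W, P x) ↔ ∃ ε > 0, ∀ x, 0 < W x → W x < ε → P x := by
  unfold LF
  rw [Filter.eventually_comap]
  constructor
  · intro h
    rw [eventually_nhdsWithin_iff, Metric.eventually_nhds_iff] at h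
    obtain ⟨ε, he, h⟩ := h
    refine ⟨ε, he, fun x h0 h1 => h (y := W x) ?_ h0 x rfl⟩
    rw [Real.dist_eq, sub_zero, abs_of_pos h0]; exact h1
  · rintro ⟨ε, he, h⟩
    filter_upwards [Ioo_mem_nhdsGT he] with y hy x hx
    subst hx
    exact h x hy.1 hy.2

lemma LF_pos (W : ℝ → ℝ) : ∀ᶠ x in LF W, 0 < W x :=
  ev_LF.2 ⟨1, one_pos, fun _ h _ => h⟩

lemma LF_tendsto (W : ℝ → ℝ) : Tendsto W (LF W) (𝓝[>] 0) := tendsto_comap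

lemma LF_tendsto0 (W : ℝ → ℝ) : Tendsto W (LF W) (𝓝 0) :=
  (LF_tendsto W).mono_right nhdsWithin_le_nhds

lemma LF_neBot {W : ℝ → ℝ} (h : ∀ ε > 0, ∃ x, 0 < W x ∧ W x < ε) : (LF W).NeBot := by
  rw [Filter.neBot_iff]
  intro hb
  have : ∀ᶠ x in LF W, False := by rw [hb]; exact Filter.eventually_bot
  obtain ⟨ε, he, h'⟩ := ev_LF.1 this
  obtain ⟨x, h1, h2⟩ := h ε he
  exact h' x h1 h2

lemma to_LF {W g : ℝ → ℝ} {l : Filter ℝ} (h0 : Tendsto (fun x => W (g x)) l (𝓝 0))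
    (hp : ∀ᶠ x in l, 0 < W (g x)) : Tendsto g l (LF W) := by
  unfold LF
  rw [tendsto_comap_iff]
  exact tendsto_nhdsWithin_iff.2 ⟨h0, hp⟩

/-! ### Poisson-type limit -/
lemma pow_to_lin {u : ℕ → ℝ} {c : ℝ} (h0 : ∀ n, 0 ≤ u n)
    (h : Tendsto (fun n => u n ^ n) atTop (𝓝 (Real.exp (-c)))) :
    Tendsto (fun n : ℕ => (n : ℝ) * (1 - u n)) atTop (𝓝 c) := by
  have hpos : ∀ᶠ n : ℕ in atTop, 0 < u n := by
    filter_upwards [h.eventually (lt_mem_nhds (Real.exp_pos _)), eventually_ge_atTop 1] with n hn hn1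
    rcases (h0 n).lt_or_eq with h | h
    · exact h
    · rw [← h, zero_pow (by omega)] at hn; exact absurd hn (lt_irrefl _)
  have hlog : Tendsto (fun n : ℕ => (n : ℝ) * Real.log (u n)) atTop (𝓝 (-c)) := by
    have := h.log (Real.exp_ne_zero _)
    rw [Real.log_exp] at this
    simpa [Real.log_pow] using this
  have hl0 : Tendsto (fun n : ℕ => Real.log (u n)) atTop (𝓝 0) := by
    have := hlog.mul (tendsto_inv_atTop_nhds_zero_nat (𝕜 := ℝ))
    rw [mul_zero] at this
    refine this.congr' ?_
    filter_upwards [eventually_ge_atTop 1] with n hn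
    have : (n : ℝ) ≠ 0 := by positivity
    field_simp
  have hu : Tendsto u atTop (𝓝 1) := by
    have := hl0.rexp
    rw [Real.exp_zero] at this
    refine this.congr' ?_
    filter_upwards [hpos] with n hn
    exact Real.exp_log hn
  have hup : Tendsto (fun n : ℕ => -((n : ℝ) * Real.log (u n))) atTop (𝓝 c) := by
    simpa using hlog.neg
  have hlow : Tendsto (fun n : ℕ => u n * -((n : ℝ) * Real.log (u n))) atTop (𝓝 c) := by
    simpa using hu.mul hup
  refine tendsto_of_tendsto_of_tendsto_of_le_of_le' hlow hup ?_ ?_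
  · filter_upwards [hpos] with n hn
    have := Real.one_sub_inv_le_log_of_pos hn
    have h3 : -(u n * Real.log (u n)) ≤ 1 - u n := by
      have := mul_le_mul_of_nonneg_left this hn.le
      rw [mul_sub, mul_inv_cancel₀ hn.ne'] at this
      linarith
    have := mul_le_mul_of_nonneg_left h3 (Nat.cast_nonneg (α := ℝ) n)
    linarith
  · filter_upwards [hpos] with n hn
    have := Real.log_le_sub_one_of_pos hn
    have := mul_le_mul_of_nonneg_left this (Nat.cast_nonneg (α := ℝ) n)
    linarith

/-- index attached to a point -/
def NN (W : ℝ → ℝ) (t : ℝ) : ℕ := ⌊(W t)⁻¹⌋₊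

section attr
variable {W ℓ : ℝ → ℝ} {a b : ℕ → ℝ} {I : Set ℝ}

lemma small_vals (hI0 : (0:ℝ) ∈ I) (hl0 : ℓ 0 = 1)
    (hc : ∀ s ∈ I, Tendsto (fun n : ℕ => (n : ℝ) * W (a n * s + b n)) atTop (𝓝 (ℓ s))) :
    ∀ ε > 0, ∃ x, 0 < W x ∧ W x < ε := by
  intro ε he
  have h := hc 0 hI0
  rw [hl0] at h
  have e1 := h.eventually (Ioo_mem_nhds (show (1:ℝ)/2 < 1 by norm_num) (show (1:ℝ) < 2 by norm_num))
  have e2 := (tendsto_natCast_atTop_atTop (R := ℝ)).eventually_gt_atTop (2/ε)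
  obtain ⟨n, ⟨h1, h2⟩, h3⟩ := (e1.and e2).exists
  have hn : (0:ℝ) < n := lt_trans (by positivity) h3
  refine ⟨a n * 0 + b n, ?_, ?_⟩
  · by_contra hcon
    nlinarith [mul_nonneg hn.le (le_of_not_gt (not_lt.2 (neg_nonneg.2 (not_lt.1 hcon))))]
  · rw [div_lt_iff₀ he] at h3
    by_contra hcon
    nlinarith [mul_le_mul_of_nonneg_left (not_lt.1 hcon) hn.le]

lemma attr_sub (hW : Antitone W) (ha : ∀ n, 0 < a n) (hI : IsOpen I)
    (hcont : ContinuousOn ℓ I)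
    (hc : ∀ s ∈ I, Tendsto (fun n : ℕ => (n : ℝ) * W (a n * s + b n)) atTop (𝓝 (ℓ s)))
    {l : Filter ℝ} {N : ℝ → ℕ} (hN : Tendsto N l atTop) {z : ℝ → ℝ} {s : ℝ} (hs : s ∈ I)
    (hz : Tendsto z l (𝓝 s)) :
    Tendsto (fun t => (N t : ℝ) * W (a (N t) * z t + b (N t))) l (𝓝 (ℓ s)) := by
  have hca : ContinuousAt ℓ s := hcont.continuousAt (hI.mem_nhds hs)
  rw [tendsto_order]
  constructor
  · intro v hv
    have h1 : ∀ᶠ y in 𝓝 s, v < ℓ y ∧ y ∈ I :=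
      (hca.eventually (lt_mem_nhds hv)).and (hI.mem_nhds hs)
    have h2 : ∀ᶠ y in 𝓝[>] s, (v < ℓ y ∧ y ∈ I) ∧ s < y :=
      (h1.filter_mono nhdsWithin_le_nhds).and self_mem_nhdsWithin
    obtain ⟨y, ⟨hy1, hy2⟩, hy3⟩ := h2.exists
    filter_upwards [((hc y hy2).comp hN).eventually (lt_mem_nhds hy1),
      hz.eventually (gt_mem_nhds hy3)] with t h1 h2
    refine lt_of_lt_of_le h1 ?_
    refine mul_le_mul_of_nonneg_left (hW ?_) (Nat.cast_nonneg _)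
    have := mul_le_mul_of_nonneg_left h2.le (ha (N t)).le
    linarith
  · intro v hv
    have h1 : ∀ᶠ y in 𝓝 s, ℓ y < v ∧ y ∈ I :=
      (hca.eventually (gt_mem_nhds hv)).and (hI.mem_nhds hs)
    have h2 : ∀ᶠ y in 𝓝[<] s, (ℓ y < v ∧ y ∈ I) ∧ y < s :=
      (h1.filter_mono nhdsWithin_le_nhds).and self_mem_nhdsWithin
    obtain ⟨y, ⟨hy1, hy2⟩, hy3⟩ := h2.exists
    filter_upwards [((hc y hy2).comp hN).eventually (gt_mem_nhds hy1),
      hz.eventually (lt_mem_nhds hy3)] with t h1 h2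
    refine lt_of_le_of_lt ?_ h1
    refine mul_le_mul_of_nonneg_left (hW ?_) (Nat.cast_nonneg _)
    have := mul_le_mul_of_nonneg_left h2.le (ha (N t)).le
    linarith

lemma attr_main (hW : Antitone W) (ha : ∀ n, 0 < a n) (hI : IsOpen I)
    (hI0 : (0:ℝ) ∈ I) (hl0 : ℓ 0 = 1) (hcont : ContinuousOn ℓ I) (hanti : StrictAntiOn ℓ I)
    (hc : ∀ s ∈ I, Tendsto (fun n : ℕ => (n : ℝ) * W (a n * s + b n)) atTop (𝓝 (ℓ s)))
    {σ : ℝ → ℝ} {s : ℝ} (hs : s ∈ I) (hσ : Tendsto σ (LF W) (𝓝 s)) :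
    Tendsto (fun t => W (t + σ t * a (NN W t)) / W t) (LF W) (𝓝 (ℓ s)) := by
  have hinv : Tendsto (fun t => (W t)⁻¹) (LF W) atTop :=
    tendsto_inv_nhdsGT_zero.comp (LF_tendsto W)
  have hN : Tendsto (NN W) (LF W) atTop := tendsto_nat_floor_atTop.comp hinv
  have hNW : Tendsto (fun t => (NN W t : ℝ) * W t) (LF W) (𝓝 1) := by
    have := (tendsto_nat_floor_div_atTop (R := ℝ)).comp hinv
    refine this.congr fun t => ?_
    simp [NN, Function.comp]
  have hx : Tendsto (fun t => (t - b (NN W t)) / a (NN W t)) (LF W) (𝓝 0) := by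
    rw [tendsto_order]
    constructor
    · intro v hv
      have h2 : ∀ᶠ y in 𝓝[<] (0:ℝ), (y ∈ I ∧ v < y) ∧ y < 0 :=
        ((Filter.Eventually.and (hI.mem_nhds hI0) (lt_mem_nhds hv)).filter_mono
          nhdsWithin_le_nhds).and self_mem_nhdsWithin
      obtain ⟨y, ⟨hy1, hy2⟩, hy3⟩ := h2.exists
      have hl : 1 < ℓ y := by rw [← hl0]; exact hanti hy1 hI0 hy3
      filter_upwards [hNW.eventually_lt ((hc y hy1).comp hN) hl] with t ht
      have h3 := lt_of_mul_lt_mul_left ht (Nat.cast_nonneg _)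
      have h4 : a (NN W t) * y + b (NN W t) < t := by
        by_contra hcon
        exact absurd (hW (not_lt.1 hcon)) (not_le.2 h3)
      rw [lt_div_iff₀ (ha _)]
      nlinarith [ha (NN W t)]
    · intro v hv
      have h2 : ∀ᶠ y in 𝓝[>] (0:ℝ), (y ∈ I ∧ y < v) ∧ 0 < y :=
        ((Filter.Eventually.and (hI.mem_nhds hI0) (gt_mem_nhds hv)).filter_mono
          nhdsWithin_le_nhds).and self_mem_nhdsWithin
      obtain ⟨y, ⟨hy1, hy2⟩, hy3⟩ := h2.exists
      have hl : ℓ y < 1 := by rw [← hl0]; exact hanti hI0 hy1 hy3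
      filter_upwards [((hc y hy1).comp hN).eventually_lt hNW hl] with t ht
      have h3 := lt_of_mul_lt_mul_left ht (Nat.cast_nonneg _)
      have h4 : t < a (NN W t) * y + b (NN W t) := by
        by_contra hcon
        exact absurd (hW (not_lt.1 hcon)) (not_le.2 h3)
      rw [div_lt_iff₀ (ha _)]
      nlinarith [ha (NN W t)]
  have hz := hx.add hσ
  rw [zero_add] at hz
  have key := (attr_sub hW ha hI hcont hc hN hs hz).div hNW one_ne_zero
  rw [div_one] at key
  refine key.congr' ?_
  filter_upwards [hN.eventually_ge_atTop 1] with t ht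
  have h1 : ((NN W t : ℕ) : ℝ) ≠ 0 := by
    have : 0 < NN W t := ht
    positivity
  have h2 := (ha (NN W t)).ne'
  have h3 : a (NN W t) * ((t - b (NN W t)) / a (NN W t) + σ t) + b (NN W t)
      = t + σ t * a (NN W t) := by field_simp; ring
  simp only [Pi.div_apply]
  rw [h3, mul_div_mul_left _ _ h1]

end attr
/-- auxiliary Gamma-variation predicate -/
structure Good (W V h : ℝ → ℝ) : Prop where
  anti : Antitone V
  nn : ∀ x, 0 ≤ V x
  pos : ∀ x, 0 < V x ↔ 0 < W x
  hpos : ∀ x, 0 < h x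
  lim : ∀ s, 0 ≤ s → Tendsto (fun x => V (x + s * h x) / V x) (LF W) (𝓝 (Real.exp (-s)))

namespace Good
variable {W V h : ℝ → ℝ}

lemma shift_pos (g : Good W V h) {s : ℝ} (hs : 0 ≤ s) :
    ∀ᶠ x in LF W, 0 < V (x + s * h x) := by
  filter_upwards [(g.lim s hs).eventually (lt_mem_nhds (Real.exp_pos _))] with x hx
  rcases (g.nn (x + s * h x)).lt_or_eq with h1 | h1
  · exact h1
  · rw [← h1, zero_div] at hx; exact absurd hx (lt_irrefl _)

lemma shift (g : Good W V h) (hW : Antitone W) {s : ℝ} (hs : 0 ≤ s) :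
    Tendsto (fun x => x + s * h x) (LF W) (LF W) := by
  have hp : ∀ᶠ x in LF W, 0 < W (x + s * h x) := by
    filter_upwards [g.shift_pos hs] with x hx
    exact (g.pos _).1 hx
  refine to_LF ?_ hp
  refine tendsto_of_tendsto_of_tendsto_of_le_of_le' tendsto_const_nhds (LF_tendsto0 W) ?_ ?_
  · filter_upwards [hp] with x hx using hx.le
  · refine Eventually.of_forall fun x => hW ?_
    nlinarith [g.hpos x]

lemma slow (g : Good W V h) (hW : Antitone W) {s : ℝ} (hs : 0 ≤ s) :
    Tendsto (fun x => h (x + s * h x) / h x) (LF W) (𝓝 1) := by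
  have T1 : Tendsto (fun x => V (x + s * h x + 1 * h (x + s * h x)) / V (x + s * h x))
      (LF W) (𝓝 (Real.exp (-1))) := (g.lim 1 zero_le_one).comp (g.shift hW hs)
  have T2 : ∀ u, 0 ≤ u → Tendsto (fun x => V (x + (s + u) * h x) / V (x + s * h x))
      (LF W) (𝓝 (Real.exp (-u))) := by
    intro u hu
    have := (g.lim (s + u) (by positivity)).div (g.lim s hs) (Real.exp_ne_zero _)
    rw [← Real.exp_sub, show -(s + u) - -s = -u by ring] at this
    refine this.congr' ?_
    filter_upwards [LF_pos W] with x hx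
    have := ((g.pos x).2 hx).ne'
    simp only [Pi.div_apply]
    rw [div_div_div_cancel_right₀ this]
  rw [tendsto_order]
  constructor
  · intro v hv
    have hv' : max v 0 < 1 := max_lt hv one_pos
    filter_upwards [T1.eventually_lt (T2 (max v 0) (le_max_right _ _))
      (Real.exp_lt_exp.2 (neg_lt_neg hv')), g.shift_pos hs] with x hx hp
    have h1 := (div_lt_div_iff_of_pos_right hp).1 hx
    have h2 := g.anti.reflect_lt h1
    refine lt_of_le_of_lt (le_max_left v 0) ?_
    rw [lt_div_iff₀ (g.hpos x)]
    linarith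
  · intro v hv
    filter_upwards [(T2 v (by linarith)).eventually_lt T1
      (Real.exp_lt_exp.2 (neg_lt_neg hv)), g.shift_pos hs] with x hx hp
    have h1 := (div_lt_div_iff_of_pos_right hp).1 hx
    have h2 := g.anti.reflect_lt h1
    rw [div_lt_iff₀ (g.hpos x)]
    linarith

lemma intble (g : Good W V h) (x y : ℝ) : IntervalIntegrable V volume x y :=
  g.anti.intervalIntegrable

lemma crude (g : Good W V h) {x y : ℝ} (hxy : x ≤ y) : ∫ t in x..y, V t ≤ (y - x) * V x := by
  have := intervalIntegral.integral_mono_on (μ := volume) hxy (g.intble x y)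
    (intervalIntegrable_const (c := V x)) (fun t ht => g.anti ht.1)
  simpa using this

lemma bound (g : Good W V h) (hW : Antitone W) :
    ∀ᶠ x in LF W, ∀ b, x ≤ b → ∫ t in x..b, V t ≤ 4 * (h x * V x) := by
  have he : Real.exp (-1) < 1 / 2 := by
    rw [Real.exp_neg, inv_lt_comm₀ (Real.exp_pos _) (by norm_num)]
    have := Real.exp_one_gt_d9
    norm_num; linarith
  have ev : ∀ᶠ x in LF W, V (x + h x) ≤ V x / 2 ∧ 0 < V (x + h x) ∧ h (x + h x) ≤ 3 / 2 * h x := by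
    have h1 := g.lim 1 zero_le_one
    have h2 := g.slow hW zero_le_one
    have h3 := g.shift_pos zero_le_one
    filter_upwards [h1.eventually (gt_mem_nhds he),
      h2.eventually (gt_mem_nhds (show (1:ℝ) < 3/2 by norm_num)), h3, LF_pos W] with x h1 h2 h3 h4
    rw [one_mul] at h1 h2 h3
    rw [div_lt_iff₀ ((g.pos x).2 h4)] at h1
    rw [div_lt_iff₀ (g.hpos x)] at h2
    exact ⟨by linarith, h3, h2.le⟩
  obtain ⟨ε, hε, H⟩ := ev_LF.1 ev
  refine ev_LF.2 ⟨ε, hε, ?_⟩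
  have ind : ∀ n : ℕ, ∀ x, 0 < W x → W x < ε → ∀ b, x ≤ b →
      ∫ t in x..b, V t ≤ 4 * (h x * V x) * (1 - (3/4)^n) + (b - x) * (1/2)^n * V x := by
    intro n
    induction n with
    | zero =>
      intro x _ _ b hb
      simpa using g.crude hb
    | succ n ih =>
      intro x h1 h2 b hb
      obtain ⟨q1, q2, q3⟩ := H x h1 h2
      have hV := (g.pos x).2 h1
      have hh := g.hpos x
      have hhV : 0 < h x * V x := mul_pos hh hV
      have p34 : (0:ℝ) < (3/4)^n := by positivity
      have p34' : ((3:ℝ)/4)^n ≤ 1 := pow_le_one₀ (by norm_num) (by norm_num)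
      have p12 : (0:ℝ) < (1/2)^n := by positivity
      rw [pow_succ, pow_succ]
      rcases le_total b (x + h x) with hb' | hb'
      · have h3 := g.crude hb
        have h4 : (b - x) * V x ≤ h x * V x :=
          mul_le_mul_of_nonneg_right (by linarith) hV.le
        have h5 : 0 ≤ (b - x) * ((1/2)^n * (1/2)) * V x :=
          mul_nonneg (mul_nonneg (by linarith) (by positivity)) hV.le
        nlinarith
      · have h3 := g.crude (show x ≤ x + h x by linarith)
        have h4 := ih (x + h x) ((g.pos _).1 q2)
          (lt_of_le_of_lt (hW (by linarith)) h2) b hb'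
        rw [← intervalIntegral.integral_add_adjacent_intervals (g.intble x (x + h x))
          (g.intble (x + h x) b)]
        have h5 : h (x + h x) * V (x + h x) ≤ 3 / 4 * (h x * V x) := by
          calc h (x + h x) * V (x + h x) ≤ (3/2 * h x) * (V x / 2) :=
                mul_le_mul q3 q1 q2.le (by positivity)
            _ = _ := by ring
        have h6 : 4 * (h (x + h x) * V (x + h x)) * (1 - (3/4)^n)
            ≤ 4 * (3 / 4 * (h x * V x)) * (1 - (3/4)^n) :=
          mul_le_mul_of_nonneg_right (by linarith) (by linarith)
        have h7 : (b - (x + h x)) * (1/2)^n * V (x + h x) ≤ (b - x) * (1/2)^n * (V x / 2) := by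
          refine mul_le_mul ?_ q1 q2.le (mul_nonneg (by linarith) p12.le)
          exact mul_le_mul_of_nonneg_right (by linarith) p12.le
        have h8 : x + h x - x = h x := by ring
        rw [h8] at h3
        nlinarith
  intro x h1 h2 b hb
  have l1 : Tendsto (fun n : ℕ => 4 * (h x * V x) * (1 - (3/4:ℝ)^n) + (b - x) * (1/2)^n * V x)
      atTop (𝓝 (4 * (h x * V x) * (1 - 0) + (b - x) * 0 * V x)) := by
    have e1 := tendsto_pow_atTop_nhds_zero_of_lt_one (r := (3/4:ℝ)) (by norm_num) (by norm_num)
    have e2 := tendsto_pow_atTop_nhds_zero_of_lt_one (r := (1/2:ℝ)) (by norm_num) (by norm_num)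
    exact ((e1.const_sub 1).const_mul _).add ((e2.const_mul _).mul_const _)
  have := ge_of_tendsto' l1 (fun n => ind n x h1 h2 b hb)
  linarith

lemma integrable_ev (g : Good W V h) (hW : Antitone W) :
    ∀ᶠ x in LF W, IntegrableOn V (Ioi x) := by
  filter_upwards [g.bound hW] with x hx
  refine integrableOn_Ioi_of_intervalIntegral_norm_bounded (4 * (h x * V x)) x
    (b := fun n : ℝ => n) (l := atTop) (fun i => ?_) tendsto_id ?_
  · exact (g.anti.antitoneOn _ |>.integrableOn_isCompact isCompact_Icc).mono_set Ioc_subset_Icc_self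
  · filter_upwards [eventually_ge_atTop x] with b hb
    simp only [Real.norm_of_nonneg (g.nn _)]
    exact hx b hb

lemma integrable (g : Good W V h) (hW : Antitone W) (hne : (LF W).NeBot) (x : ℝ) :
    IntegrableOn V (Ioi x) := by
  obtain ⟨c, hc⟩ := (g.integrable_ev hW).exists
  have h1 : IntegrableOn V (Icc x c) :=
    (g.anti.antitoneOn _ |>.integrableOn_isCompact isCompact_Icc)
  refine (h1.union hc).mono_set ?_
  intro t ht
  rcases le_or_gt t c with h | h
  · exact Or.inl ⟨le_of_lt ht, h⟩
  · exact Or.inr h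

/-- tail integral -/
def _root_.UU (V : ℝ → ℝ) (x : ℝ) : ℝ := ∫ t in Ioi x, V t

lemma split (g : Good W V h) (hW : Antitone W) (hne : (LF W).NeBot) (x y : ℝ) :
    UU V x = (∫ t in x..y, V t) + UU V y :=
  (intervalIntegral.integral_interval_add_Ioi (g.integrable hW hne x) (g.integrable hW hne y)).symm

lemma UU_nn (g : Good W V h) (x : ℝ) : 0 ≤ UU V x :=
  integral_nonneg fun t => g.nn t

lemma UU_le (g : Good W V h) (hW : Antitone W) (hne : (LF W).NeBot) :
    ∀ᶠ x in LF W, UU V x ≤ 4 * (h x * V x) := by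
  filter_upwards [g.bound hW] with x hx
  refine le_of_tendsto (intervalIntegral_tendsto_integral_Ioi x (g.integrable hW hne x) tendsto_id) ?_
  filter_upwards [eventually_ge_atTop x] with b hb using hx b hb

lemma part (g : Good W V h) {S : ℝ} (hS : 0 ≤ S) :
    Tendsto (fun x => (∫ t in x..(x + S * h x), V t) / (h x * V x)) (LF W)
      (𝓝 (1 - Real.exp (-S))) := by
  have hI : ∫ r in (0:ℝ)..S, Real.exp (-r) = 1 - Real.exp (-S) := by
    rw [intervalIntegral.integral_comp_neg (fun r => Real.exp r)]
    simp
  rw [← hI]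
  have key : Tendsto (fun x => ∫ r in (0:ℝ)..S, V (x + r * h x) / V x) (LF W)
      (𝓝 (∫ r in (0:ℝ)..S, Real.exp (-r))) := by
    refine intervalIntegral.tendsto_integral_filter_of_dominated_convergence (fun _ => (1:ℝ))
      ?_ ?_ ?_ ?_
    · refine Eventually.of_forall fun x => ?_
      have : Measurable V := g.anti.measurable
      exact Measurable.aestronglyMeasurable (by fun_prop)
    · filter_upwards [LF_pos W] with x hx
      refine Eventually.of_forall fun r hr => ?_
      rw [uIoc_of_le hS] at hr
      rw [Real.norm_of_nonneg (div_nonneg (g.nn _) (g.nn _))]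
      refine div_le_one_of_le₀ (g.anti ?_) (g.nn _)
      nlinarith [g.hpos x, hr.1]
    · exact intervalIntegrable_const
    · refine Eventually.of_forall fun r hr => ?_
      rw [uIoc_of_le hS] at hr
      exact g.lim r hr.1.le
  refine key.congr' ?_
  filter_upwards [LF_pos W] with x hx
  have h1 := (g.hpos x).ne'
  rw [intervalIntegral.integral_div]
  have h2 := intervalIntegral.integral_comp_add_mul (a := 0) (b := S) V h1 x
  simp only [mul_comm (h x)] at h2
  rw [h2, smul_eq_mul]
  simp only [zero_mul, add_zero]
  field_simp

lemma UU_asymp (g : Good W V h) (hW : Antitone W) (hne : (LF W).NeBot) :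
    Tendsto (fun x => UU V x / (h x * V x)) (LF W) (𝓝 1) := by
  have hex : Tendsto (fun S : ℝ => Real.exp (-S)) atTop (𝓝 0) := Real.tendsto_exp_neg_atTop_nhds_zero
  rw [tendsto_order]
  constructor
  · intro v hv
    have e0 : Tendsto (fun S : ℝ => 1 - Real.exp (-S)) atTop (𝓝 1) := by simpa using hex.const_sub 1
    obtain ⟨S, hS1, hS0⟩ := ((e0.eventually (lt_mem_nhds hv)).and (eventually_ge_atTop 0)).exists
    filter_upwards [(g.part hS0).eventually (lt_mem_nhds hS1), LF_pos W] with x hx hp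
    refine lt_of_lt_of_le hx ?_
    refine div_le_div_of_nonneg_right ?_ (mul_pos (g.hpos x) ((g.pos x).2 hp)).le
    rw [g.split hW hne x (x + S * h x)]
    linarith [g.UU_nn (x + S * h x)]
  · intro v hv
    have e0 : Tendsto (fun S : ℝ => (1 - Real.exp (-S)) + 4 * (1 * Real.exp (-S))) atTop (𝓝 1) := by
      simpa using (hex.const_sub 1).add ((hex.const_mul 1).const_mul 4)
    obtain ⟨S, hS1, hS0⟩ := ((e0.eventually (gt_mem_nhds hv)).and (eventually_ge_atTop 0)).exists
    have T := (g.part hS0).add (((g.slow hW hS0).mul (g.lim S hS0)).const_mul 4)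
    filter_upwards [T.eventually (gt_mem_nhds hS1), LF_pos W,
      (g.shift hW hS0).eventually (g.UU_le hW hne)] with x hx hp hu
    refine lt_of_le_of_lt ?_ hx
    have h1 := g.hpos x
    have h2 := (g.pos x).2 hp
    rw [g.split hW hne x (x + S * h x), add_div]
    gcongr
    rw [div_mul_div_comm, ← mul_div_assoc]
    gcongr

lemma next (g : Good W V h) (hW : Antitone W) (hne : (LF W).NeBot)
    (hop : ∀ x, 0 < W x → ∃ y, x < y ∧ 0 < W y) : Good W (UU V) h where
  anti := by
    intro x y hxy
    rw [g.split hW hne x y]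
    have := intervalIntegral.integral_nonneg (μ := volume) hxy (fun t _ => g.nn t)
    linarith
  nn := g.UU_nn
  hpos := g.hpos
  pos := by
    intro x
    constructor
    · intro hx
      by_contra hcon
      have : UU V x = 0 := by
        unfold UU
        rw [setIntegral_congr_fun (g := fun _ => (0:ℝ)) measurableSet_Ioi]
        · simp
        · intro t ht
          have h0 : ¬ 0 < V x := fun h' => hcon ((g.pos x).1 h')
          have := g.anti (le_of_lt ht)
          exact le_antisymm (by linarith [not_lt.1 h0]) (g.nn t)
      linarith
    · intro hx
      obtain ⟨y, hy, hWy⟩ := hop x hx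
      have hV := (g.pos y).2 hWy
      rw [g.split hW hne x y]
      have h1 := intervalIntegral.integral_mono_on (μ := volume) hy.le
        (intervalIntegrable_const (c := V y)) (g.intble x y) (fun t ht => g.anti ht.2)
      simp at h1
      have := mul_pos (sub_pos.2 hy) hV
      linarith [g.UU_nn y]
  lim := by
    intro s hs
    have A1 := g.UU_asymp hW hne
    have A2 := A1.comp (g.shift hW hs)
    have T := (A2.div A1 one_ne_zero).mul ((g.slow hW hs).mul (g.lim s hs))
    simp only [div_one, one_mul] at T
    refine T.congr' ?_
    filter_upwards [LF_pos W, g.shift_pos hs, A1.eventually (lt_mem_nhds one_pos)] with x hx hp hu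
    have h1 := (g.hpos x).ne'
    have h2 := ((g.pos x).2 hx).ne'
    have h3 := (g.hpos (x + s * h x)).ne'
    have h5 : UU V x ≠ 0 := by
      intro h0; rw [h0, zero_div] at hu; exact lt_irrefl _ hu
    simp only [Pi.div_apply, Function.comp]
    have hp' := hp.ne'
    generalize V (x + s * h x) = v1 at *
    generalize h (x + s * h x) = v2 at *
    generalize UU V (x + s * h x) = v3 at *
    field_simp

lemma iter (G : ℝ → ℝ) (g : Good (fun x => 1 - G x) (fun x => 1 - G x) h)
    (hW : Antitone (fun x => 1 - G x)) (hne : (LF (fun x => 1 - G x)).NeBot)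
    (hop : ∀ x, 0 < 1 - G x → ∃ y, x < y ∧ 0 < 1 - G y) (k : ℕ) :
    Good (fun x => 1 - G x) (iterIntInf G k) h ∧
    Tendsto (fun x => iterIntInf G k x / (h x ^ (k + 1) * (1 - G x))) (LF (fun x => 1 - G x)) (𝓝 1) := by
  induction k with
  | zero =>
    refine ⟨g.next hW hne hop, ?_⟩
    simp only [zero_add, pow_one]
    exact g.UU_asymp hW hne
  | succ k ih =>
    obtain ⟨g1, l1⟩ := ih
    refine ⟨g1.next hW hne hop, ?_⟩
    have T := (g1.UU_asymp hW hne).mul l1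
    rw [one_mul] at T
    refine T.congr' ?_
    filter_upwards [LF_pos _] with x hx
    have h1 := (g.hpos x).ne'
    have h2 := ((g1.pos x).2 hx).ne'
    change _ = UU (iterIntInf G k) x / _
    generalize UU (iterIntInf G k) x = v
    have h3 := hx.ne'
    field_simp
    ring

lemma final (G : ℝ → ℝ) (g : Good (fun x => 1 - G x) (fun x => 1 - G x) h)
    (hW : Antitone (fun x => 1 - G x)) (hne : (LF (fun x => 1 - G x)).NeBot)
    (hop : ∀ x, 0 < 1 - G x → ∃ y, x < y ∧ 0 < 1 - G y) (p : ℕ) (hp : 1 ≤ p) :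
    Tendsto (fun x => RpInf p x G / (RpInf 1 x G) ^ p) (LF (fun x => 1 - G x)) (𝓝 1) := by
  obtain ⟨k, rfl⟩ : ∃ k, p = k + 1 := ⟨p - 1, by omega⟩
  have h1 := (iter G g hW hne hop k).2
  have h2 := (iter G g hW hne hop 0).2
  have T := h1.div (h2.pow (k + 1)) (by simp)
  simp only [one_pow, div_one] at T
  refine T.congr' ?_
  filter_upwards [LF_pos _, h2.eventually (lt_mem_nhds one_pos)] with x hx hu
  have q1 := (g.hpos x).ne'
  have q3 := hx.ne'
  have q4 : iterIntInf G 0 x ≠ 0 := by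
    intro h0; rw [h0, zero_div] at hu; exact lt_irrefl _ hu
  simp only [Pi.div_apply, RpInf, Nat.add_sub_cancel, Nat.sub_self, zero_add, pow_one]
  rw [div_pow, mul_pow, mul_pow, inv_pow]
  field_simp

end Good
lemma exp_LF (W : ℝ → ℝ) : Tendsto Real.exp (LF (fun x => W (Real.exp x))) (LF W) := by
  unfold LF
  rw [tendsto_comap_iff]
  exact tendsto_comap

section transfer
variable {W : ℝ → ℝ} {a : ℕ → ℝ}

lemma ev_gt_one (h1 : ∀ t ≤ 1, W t = 1) : ∀ᶠ t in LF W, 1 < t := by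
  refine ev_LF.2 ⟨1, one_pos, fun t _ h => ?_⟩
  by_contra hc
  rw [h1 t (not_lt.1 hc)] at h
  exact lt_irrefl _ h

lemma ev_back (h1 : ∀ t ≤ 1, W t = 1) {s c : ℝ}
    (hT : Tendsto (fun t => W (t + (-s) * a (NN W t)) / W t) (LF W) (𝓝 c)) :
    ∀ᶠ t in LF W, s * a (NN W t) < t := by
  have := hT.mul (LF_tendsto0 W)
  rw [mul_zero] at this
  filter_upwards [this.eventually (gt_mem_nhds one_pos), LF_pos W] with t ht hp
  rw [div_mul_cancel₀ _ hp.ne'] at ht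
  by_contra hc
  rw [h1 _ (by linarith [not_lt.1 hc])] at ht
  exact lt_irrefl _ ht

lemma gumbel_good (hW : Antitone W) (h0 : ∀ t, 0 ≤ W t) (h1 : ∀ t ≤ 1, W t = 1)
    (ha : ∀ n, 0 < a n)
    (key : ∀ (σ : ℝ → ℝ) (s : ℝ), Tendsto σ (LF W) (𝓝 s) →
      Tendsto (fun t => W (t + σ t * a (NN W t)) / W t) (LF W) (𝓝 (Real.exp (-s)))) :
    ∃ h, Good (fun x => W (Real.exp x)) (fun x => W (Real.exp x)) h := by
  have hf : Tendsto (fun t => a (NN W t) / t) (LF W) (𝓝 0) := by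
    rw [tendsto_order]
    constructor
    · intro v hv
      filter_upwards [ev_gt_one h1] with t ht
      exact lt_trans hv (div_pos (ha _) (by linarith))
    · intro v hv
      filter_upwards [ev_gt_one h1, ev_back h1 (key (fun _ => -v⁻¹) (-v⁻¹) tendsto_const_nhds)]
        with t ht h2
      rw [div_lt_iff₀ (by linarith)]
      have := mul_lt_mul_of_pos_left h2 hv
      rwa [mul_inv_cancel_left₀ hv.ne'] at this
  refine ⟨fun x => a (NN W (Real.exp x)) / Real.exp x, ?_, fun x => h0 _, fun x => Iff.rfl,
    fun x => div_pos (ha _) (Real.exp_pos _), ?_⟩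
  · intro x y hxy
    exact hW (Real.exp_le_exp.2 hxy)
  · intro s hs
    have hf' : Tendsto (fun t => a (NN W t) / t) (LF W) (𝓝[≠] 0) := by
      refine tendsto_nhdsWithin_iff.2 ⟨hf, ?_⟩
      filter_upwards [ev_gt_one h1] with t ht
      exact (div_pos (ha _) (by linarith)).ne'
    have hd : HasDerivAt (fun d : ℝ => Real.exp (s * d)) s 0 := by
      have := ((hasDerivAt_id (0:ℝ)).const_mul s).exp
      simpa using this
    have hsl := (hasDerivAt_iff_tendsto_slope.1 hd).comp hf'
    have K := (key _ s hsl).comp (exp_LF W)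
    refine K.congr fun x => ?_
    simp only [Function.comp, slope, vsub_eq_sub, smul_eq_mul, sub_zero, mul_zero, Real.exp_zero]
    congr 2
    rw [Real.exp_add]
    have e1 := (Real.exp_pos x).ne'
    have e2 := (ha (NN W (Real.exp x))).ne'
    field_simp
    ring

lemma min_a (ha : ∀ n, 0 < a n) (K : ℕ) : ∃ m > 0, ∀ n ≤ K, m ≤ a n := by
  obtain ⟨k, _, hk⟩ := Finset.exists_min_image (Finset.range (K + 1)) a ⟨0, by simp⟩
  exact ⟨a k, ha k, fun n hn => hk n (by simp; omega)⟩

lemma frechet_ratio (hW : Antitone W) (h0 : ∀ t, 0 ≤ W t) (h1 : ∀ t ≤ 1, W t = 1)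
    (ha : ∀ n, 0 < a n) (hne : (LF W).NeBot)
    (hop : ∀ x, 0 < W x → ∃ y, x < y ∧ 0 < W y) {γ : ℝ} (hγ : 0 < γ)
    (key : ∀ (σ : ℝ → ℝ) (s : ℝ), -1 < s → Tendsto σ (LF W) (𝓝 s) →
      Tendsto (fun t => W (t + σ t * a (NN W t)) / W t) (LF W) (𝓝 ((1 + s) ^ (-γ)))) :
    Tendsto (fun t => a (NN W t) / t) (LF W) (𝓝 1) := by
  have keyc : ∀ s : ℝ, -1 < s →
      Tendsto (fun t => W (t + s * a (NN W t)) / W t) (LF W) (𝓝 ((1 + s) ^ (-γ))) :=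
    fun s hs => key (fun _ => s) s hs tendsto_const_nhds
  -- backward halving
  have half : Tendsto (fun t => t + (-(1/2)) * a (NN W t)) (LF W) (LF W) := by
    have T := (keyc (-(1/2)) (by norm_num)).mul (LF_tendsto0 W)
    rw [mul_zero] at T
    refine to_LF (T.congr' ?_) ?_
    · filter_upwards [LF_pos W] with t ht
      rw [div_mul_cancel₀ _ ht.ne']
    · filter_upwards [LF_pos W] with t ht
      refine lt_of_lt_of_le ht (hW ?_)
      linarith [ha (NN W t)]
  have hdec : ∀ ε > 0, ∀ᶠ t in LF W,
      a (NN W (t + (-(1/2)) * a (NN W t))) < (1/2 + ε) * a (NN W t) := by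
    intro ε hε
    have T1 := (keyc 1 (by norm_num)).comp half
    have T2 := (keyc ε (by linarith)).div (keyc (-(1/2)) (by norm_num)) (by positivity)
    have hlt : (1 + ε) ^ (-γ) / (1 + -(1/2)) ^ (-γ) < ((1:ℝ) + 1) ^ (-γ) := by
      rw [← Real.div_rpow (by positivity) (by norm_num)]
      refine Real.rpow_lt_rpow_of_neg (by norm_num) ?_ (by linarith)
      rw [lt_div_iff₀ (by norm_num)]; linarith
    filter_upwards [T2.eventually_lt T1 hlt, LF_pos W] with t ht hp
    have hy : 0 < W (t + (-(1/2)) * a (NN W t)) :=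
      lt_of_lt_of_le hp (hW (by linarith [ha (NN W t)]))
    simp only [Pi.div_apply, Function.comp] at ht
    rw [div_div_div_cancel_right₀ hp.ne'] at ht
    have h3 := hW.reflect_lt ((div_lt_div_iff_of_pos_right hy).1 ht)
    linarith
  -- excess bound
  have exc : ∀ δ > 0, ∃ c, 0 < W c ∧ ∀ t, 0 < W t → c ≤ t → t ≤ (1 + δ) * a (NN W t) + c := by
    intro δ hδ
    obtain ⟨ε, hε, H⟩ := ev_LF.1 (hdec (δ / 2 / (1 + δ)) (by positivity))
    obtain ⟨c, hc1, hc2⟩ := ((LF_pos W).and (ev_LF.2 ⟨ε, hε, fun x _ h => h⟩ :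
      ∀ᶠ x in LF W, W x < ε)).exists
    refine ⟨c, hc1, ?_⟩
    intro t ht hct
    obtain ⟨m, hm, hma⟩ := min_a ha (NN W t)
    have hmy : ∀ y ≤ t, m ≤ a (NN W y) := by
      intro y hy
      refine hma _ (Nat.floor_le_floor ?_)
      exact inv_anti₀ ht (hW hy)
    have ind : ∀ k : ℕ, ∀ y, y ≤ t → y ≤ c + k * (m / 2) → y ≤ (1 + δ) * a (NN W y) + c := by
      intro k
      induction k with
      | zero =>
        intro y _ hy
        have := mul_pos (show 0 < 1 + δ by linarith) (ha (NN W y))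
        simp at hy; linarith
      | succ k ih =>
        intro y hyt hy
        have hay := ha (NN W y)
        have hmy' := hmy y hyt
        rcases le_or_gt y c with hyc | hyc
        · have := mul_pos (show 0 < 1 + δ by linarith) hay
          linarith
        · have hWy : 0 < W y := lt_of_lt_of_le ht (hW hyt)
          have hH := H y hWy (lt_of_le_of_lt (hW hyc.le) hc2)
          have h3 := ih (y + (-(1/2)) * a (NN W y)) (by linarith)
            (by push_cast at hy; linarith)
          have h4 : (1 + δ) * a (NN W (y + (-(1/2)) * a (NN W y)))
              ≤ (1 + δ) * ((1/2 + δ / 2 / (1 + δ)) * a (NN W y)) :=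
            mul_le_mul_of_nonneg_left hH.le (by linarith)
          have h5 : (1 + δ) * ((1/2 + δ / 2 / (1 + δ)) * a (NN W y))
              = (1/2 + δ) * a (NN W y) := by
            field_simp; ring
          linarith
    obtain ⟨k, hk⟩ := exists_nat_gt ((t - c) / (m / 2))
    rw [div_lt_iff₀ (by positivity)] at hk
    exact ind k t le_rfl (by linarith)
  -- positivity everywhere
  have hall : ∀ K, 0 < W K := by
    obtain ⟨c, hc, H⟩ := exc 1 one_pos
    obtain ⟨c', hcc, hc'⟩ := hop c hc
    intro K
    set d := (c' - c) / 2 with hd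
    have hdpos : 0 < d := by rw [hd]; linarith
    set s := |K - c'| / d with hs
    have hs0 : 0 ≤ s := by positivity
    have hsd : s * d = |K - c'| := by rw [hs]; field_simp
    have T := keyc s (by linarith)
    obtain ⟨t, ⟨ht1, ht2⟩, ht3⟩ := (((T.eventually (lt_mem_nhds (show (0:ℝ) < (1+s)^(-γ) by
      positivity))).and (LF_pos W)).and (ev_LF.2 ⟨W c', hc', fun x _ h => h⟩ :
      ∀ᶠ x in LF W, W x < W c')).exists
    have htc := hW.reflect_lt ht3
    have h3 := H t ht2 (by linarith)
    have h4 : d ≤ a (NN W t) := by rw [hd]; linarith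
    have h5 : 0 < W (t + s * a (NN W t)) := by
      rcases (h0 (t + s * a (NN W t))).lt_or_eq with h | h
      · exact h
      · rw [← h, zero_div] at ht1; exact absurd ht1 (lt_irrefl _)
    refine lt_of_lt_of_le h5 (hW ?_)
    have := mul_le_mul_of_nonneg_left h4 hs0
    have := le_abs_self (K - c')
    linarith
  have evK : ∀ K, ∀ᶠ t in LF W, K < t := fun K =>
    ev_LF.2 ⟨W K, hall K, fun x _ h => hW.reflect_lt h⟩
  rw [tendsto_order]
  constructor
  · intro v hv
    -- choose δ with (1+δ) * v' < 1
    set v' := max v (1/2) with hv'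
    have hv1 : v' < 1 := max_lt hv (by norm_num)
    have hv0 : 0 < v' := lt_of_lt_of_le (by norm_num) (le_max_right _ _)
    have hδ : 0 < (1 - v') / 2 := by linarith
    obtain ⟨c, hc, H⟩ := exc _ hδ
    have hq : 0 < 1 - (1 + (1 - v') / 2) * v' := by nlinarith
    filter_upwards [evK (max c 1), evK (c / (1 - (1 + (1 - v') / 2) * v'))] with t h2 h3
    have h4 := H t (hall t) ((le_max_left _ _).trans h2.le)
    have ht : 1 < t := lt_of_le_of_lt (le_max_right _ _) h2
    rw [div_lt_iff₀ hq] at h3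
    refine lt_of_le_of_lt (le_max_left v (1/2)) ?_
    rw [← hv', lt_div_iff₀ (by linarith)]
    have h5 : (1 + (1 - v') / 2) * (v' * t) < (1 + (1 - v') / 2) * a (NN W t) := by linarith
    exact lt_of_mul_lt_mul_left h5 (by linarith)
  · intro v hv
    have hv0 : 0 < v := by linarith
    have : v⁻¹ < 1 := inv_lt_one_of_one_lt₀ hv
    filter_upwards [ev_gt_one h1, ev_back h1 (keyc (-v⁻¹) (by linarith))] with t ht h2
    rw [div_lt_iff₀ (by linarith)]
    have := mul_lt_mul_of_pos_left h2 hv0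
    rwa [mul_inv_cancel_left₀ hv0.ne'] at this

lemma frechet_good (hW : Antitone W) (h0 : ∀ t, 0 ≤ W t) (h1 : ∀ t ≤ 1, W t = 1)
    (ha : ∀ n, 0 < a n) (hne : (LF W).NeBot)
    (hop : ∀ x, 0 < W x → ∃ y, x < y ∧ 0 < W y) {γ : ℝ} (hγ : 0 < γ)
    (key : ∀ (σ : ℝ → ℝ) (s : ℝ), -1 < s → Tendsto σ (LF W) (𝓝 s) →
      Tendsto (fun t => W (t + σ t * a (NN W t)) / W t) (LF W) (𝓝 ((1 + s) ^ (-γ)))) :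
    ∃ h, Good (fun x => W (Real.exp x)) (fun x => W (Real.exp x)) h := by
  have hf := frechet_ratio hW h0 h1 ha hne hop hγ key
  refine ⟨fun _ => γ⁻¹, ?_, fun x => h0 _, fun x => Iff.rfl, fun x => by positivity, ?_⟩
  · intro x y hxy
    exact hW (Real.exp_le_exp.2 hxy)
  · intro s hs
    have hσ : Tendsto (fun t => (Real.exp (s * γ⁻¹) - 1) * (a (NN W t) / t)⁻¹) (LF W)
        (𝓝 (Real.exp (s * γ⁻¹) - 1)) := by
      simpa using (hf.inv₀ one_ne_zero).const_mul (Real.exp (s * γ⁻¹) - 1)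
    have K := (key _ _ (by linarith [Real.exp_pos (s * γ⁻¹)]) hσ).comp (exp_LF W)
    have e : (1 + (Real.exp (s * γ⁻¹) - 1)) ^ (-γ) = Real.exp (-s) := by
      rw [add_sub_cancel, ← Real.exp_mul]
      congr 1
      field_simp
    rw [e] at K
    refine K.congr fun x => ?_
    simp only [Function.comp]
    congr 2
    rw [Real.exp_add]
    have e1 := (Real.exp_pos x).ne'
    have e2 := (ha (NN W (Real.exp x))).ne'
    field_simp
    ring

end transfer

lemma good_of_dom (F : ℝ → ℝ) (hm : Monotone F) (hn : ∀ t, 0 ≤ F t) (hle : ∀ t, F t ≤ 1)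
    (hF1 : F 1 = 0) (hop : ∀ x, 0 < 1 - F x → ∃ y, x < y ∧ 0 < 1 - F y)
    (hdom : MemDomAttr F gumbelDF ∨ MemFrechetDom F) :
    (∀ ε > 0, ∃ x, 0 < 1 - F x ∧ 1 - F x < ε) ∧
    ∃ h, Good (fun x => 1 - F (Real.exp x)) (fun x => 1 - F (Real.exp x)) h := by
  have hW : Antitone (fun t => 1 - F t) := fun x y h => by have := hm h; simp only; linarith
  have h0 : ∀ t, 0 ≤ 1 - F t := fun t => by linarith [hle t]
  have h1 : ∀ t ≤ 1, 1 - F t = 1 := fun t ht => by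
    have := hm ht
    have := hn t
    linarith
  rcases hdom with ⟨a, b, ha, hc⟩ | ⟨γ, hγ, a, b, ha, hc⟩
  · have hc' : ∀ s ∈ (univ : Set ℝ), Tendsto
        (fun n : ℕ => (n : ℝ) * (fun t => 1 - F t) (a n * s + b n)) atTop
        (𝓝 ((fun s => Real.exp (-s)) s)) := by
      intro s _
      refine pow_to_lin (fun n => hn _) (hc s ?_)
      unfold gumbelDF
      fun_prop
    have sm := small_vals (W := fun t => 1 - F t) (mem_univ 0) (by simp) hc'
    refine ⟨sm, ?_⟩
    refine gumbel_good (W := fun t => 1 - F t) (a := a) hW h0 h1 ha fun σ s hσ => ?_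
    exact attr_main hW ha isOpen_univ (mem_univ 0) (by simp) (by fun_prop)
      (fun x _ y _ h => Real.exp_lt_exp.2 (neg_lt_neg h)) hc' (mem_univ s) hσ
  · have hc' : ∀ s ∈ Ioi (-1 : ℝ), Tendsto
        (fun n : ℕ => (n : ℝ) * (fun t => 1 - F t) (a n * s + (a n + b n))) atTop
        (𝓝 ((fun s => (1 + s) ^ (-γ)) s)) := by
      intro s hs
      have hs' : 0 < 1 + s := by have := mem_Ioi.1 hs; linarith
      refine pow_to_lin (fun n => hn _) ?_
      have hcont : ContinuousAt (frechetDF γ) (1 + s) := by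
        have : (fun x : ℝ => Real.exp (-(x ^ (-γ)))) =ᶠ[𝓝 (1 + s)] frechetDF γ := by
          filter_upwards [lt_mem_nhds hs'] with x hx
          simp [frechetDF, hx]
        refine ContinuousAt.congr ?_ this
        have := Real.continuousAt_rpow_const (1 + s) (-γ) (Or.inl hs'.ne')
        exact this.neg.rexp
      have := hc (1 + s) hcont
      simp only [frechetDF, hs', if_true] at this
      refine this.congr fun n => ?_
      congr 2
      ring
    have hm0 : (0:ℝ) ∈ Ioi (-1:ℝ) := by simp
    have sm := small_vals (W := fun t => 1 - F t) hm0 (by simp) hc'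
    refine ⟨sm, ?_⟩
    refine frechet_good (W := fun t => 1 - F t) (a := a) hW h0 h1 ha (LF_neBot sm) hop hγ
      fun σ s hs hσ => ?_
    refine attr_main hW ha isOpen_Ioi hm0 (by simp) ?_ ?_ hc' hs hσ
    · intro x hx
      have hx' : 0 < 1 + x := by have := mem_Ioi.1 hx; linarith
      refine ContinuousAt.continuousWithinAt ?_
      exact ContinuousAt.rpow_const (by fun_prop) (Or.inl hx'.ne')
    · intro x hx y hy hxy
      have hx' : 0 < 1 + x := by have := mem_Ioi.1 hx; linarith
      exact Real.rpow_lt_rpow_of_neg hx' (by linarith) (by linarith)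

lemma up_le (G : ℝ → ℝ) (hW : Antitone (fun x => 1 - G x))
    (hsm : ∀ ε > 0, ∃ x, 0 < 1 - G x ∧ 1 - G x < ε)
    (hop : ∀ x, 0 < 1 - G x → ∃ y, x < y ∧ 0 < 1 - G y) :
    upEndFilter G ≤ LF (fun x => 1 - G x) := by
  have main : ∀ P : ℝ → Prop, (∀ᶠ x in LF (fun x => 1 - G x), P x) → ∀ᶠ x in upEndFilter G, P x := by
    intro P hP
    obtain ⟨ε, hε, H⟩ := ev_LF.1 hP
    obtain ⟨c, hc1, hc2⟩ := hsm ε hε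
    have hcS : c ∈ {x | G x < 1} := by simp only [mem_setOf_eq]; linarith
    have H' : ∀ x y, c ≤ x → x < y → G y < 1 → P x := by
      intro x y hcx hxy hy
      have h1 := hW hxy.le
      have h2 := hW hcx
      simp only at h1 h2
      exact H x (by linarith) (by linarith)
    unfold upEndFilter
    split_ifs with hb
    · obtain ⟨c', hcc, hc'⟩ := hop c hc1
      have : c < upEnd G := lt_of_lt_of_le hcc (le_csSup hb (by simp only [mem_setOf_eq]; linarith))
      filter_upwards [Ioo_mem_nhdsLT this] with x hx
      obtain ⟨y, hy, hxy⟩ := exists_lt_of_lt_csSup ⟨c, hcS⟩ hx.2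
      exact H' x y hx.1.le hxy hy
    · filter_upwards [eventually_ge_atTop c] with x hx
      obtain ⟨y, hy, hxy⟩ := not_bddAbove_iff.1 hb x
      exact H' x y hx hxy hy
  exact fun s hs => main (fun x => x ∈ s) hs

/-- Lemma 4.1(ii). -/
theorem Rp_asymp_gumbel (F : ℝ → ℝ) (hF : IsDF F) (hF1 : F 1 = 0)
    (hdom : MemDomAttr F gumbelDF ∨ MemFrechetDom F)
    (G : ℝ → ℝ) (hG : G = fun x => F (Real.exp x)) (p : ℕ) (hp : 1 ≤ p) :
    Tendsto (fun x => RpInf p x G / (RpInf 1 x G) ^ p) (upEndFilter G) (𝓝 1) := by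
  obtain ⟨hm, hrc, hbot, htop⟩ := hF
  have hn : ∀ t, 0 ≤ F t := fun t => hm.le_of_tendsto hbot t
  have hle : ∀ t, F t ≤ 1 := fun t => hm.ge_of_tendsto htop t
  have hop : ∀ x, 0 < 1 - F x → ∃ y, x < y ∧ 0 < 1 - F y := by
    intro x hx
    have h1 : ∀ᶠ y in 𝓝[>] x, F y < 1 :=
      ((hrc x).eventually (gt_mem_nhds (show F x < 1 by linarith))).filter_mono
        (nhdsWithin_mono x Ioi_subset_Ici_self)
    obtain ⟨y, hy1, hy2⟩ := (h1.and self_mem_nhdsWithin).exists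
    exact ⟨y, hy2, by linarith⟩
  obtain ⟨sm, h, g⟩ := good_of_dom F hm hn hle hF1 hop hdom
  subst hG
  have hW : Antitone (fun x => 1 - F (Real.exp x)) := g.anti
  have smG : ∀ ε > 0, ∃ x, 0 < 1 - F (Real.exp x) ∧ 1 - F (Real.exp x) < ε := by
    intro ε hε
    obtain ⟨x, hx1, hx2⟩ := sm (min ε 1) (lt_min hε one_pos)
    have hx : 1 < x := by
      by_contra hc
      have := hm (not_lt.1 hc)
      have := hn x
      have := min_le_right ε 1
      linarith
    refine ⟨Real.log x, ?_⟩
    rw [Real.exp_log (by linarith)]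
    exact ⟨hx1, lt_of_lt_of_le hx2 (min_le_left _ _)⟩
  have hopG : ∀ x, 0 < 1 - F (Real.exp x) → ∃ y, x < y ∧ 0 < 1 - F (Real.exp y) := by
    intro x hx
    obtain ⟨y, hy, hy'⟩ := hop _ hx
    have hy0 := (Real.exp_pos x).trans hy
    refine ⟨Real.log y, (Real.lt_log_iff_exp_lt hy0).2 hy, ?_⟩
    rwa [Real.exp_log hy0]
  exact (Good.final (fun x => F (Real.exp x)) g hW (LF_neBot smG) hopG p hp).mono_left
    (up_le _ hW smG hopG)

end
end
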